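/- arXiv:math/0401148 — 2 statements merged into one kernel-verified Lean document; each statement's English description precedes it below -/
import Mathlib

section
/- Let s ∈ (1/2, 1), let ψ be an approximating function, and let Q be a non-degenerate rational quadric in the plane. If ∑_{h=1}^∞ h^{1−s} ψ(h)^{s+1} < ∞, then ℋ^s(Q ∩ S₂(ψ)) = 0. -/
open MeasureTheory Filter

/-- The distance from a real number to the nearest integer. -/
noncomputable def distNearestInt (x : ℝ) : ℝ := |x - round x|

/-- An approximating function: a decreasing function `ℝ₊ → ℝ₊` taking positive values. -/
def IsApproxFun (ψ : ℝ → ℝ) : Prop :=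
  (∀ x y : ℝ, 0 < x → x ≤ y → ψ y ≤ ψ x) ∧ ∀ x : ℝ, 0 < x → 0 < ψ x

/-- The set `S₂(ψ)` of simultaneously `ψ`-approximable points of the plane. -/
def SimApprox2 (ψ : ℝ → ℝ) : Set (ℝ × ℝ) :=
  {y : ℝ × ℝ |
    {q : ℕ | 0 < q ∧
      max (distNearestInt (q * y.1)) (distNearestInt (q * y.2)) < ψ q}.Infinite}

/-- A non-degenerate rational quadric in the plane: the image of the unit circle,
the standard parabola, or the standard hyperbola under an invertible affine
transformation of the plane with rational coefficients. -/
def IsRatQuadric (Q : Set (ℝ × ℝ)) : Prop :=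
  ∃ a b c d e g : ℚ, a * d - b * c ≠ 0 ∧
    ∃ S : Set (ℝ × ℝ),
      (S = {p : ℝ × ℝ | p.1 ^ 2 + p.2 ^ 2 = 1} ∨
       S = {p : ℝ × ℝ | p.2 = p.1 ^ 2} ∨
       S = {p : ℝ × ℝ | p.1 ^ 2 - p.2 ^ 2 = 1}) ∧
      Q = (fun p : ℝ × ℝ =>
        ((a : ℝ) * p.1 + (b : ℝ) * p.2 + (e : ℝ),
         (c : ℝ) * p.1 + (d : ℝ) * p.2 + (g : ℝ))) '' S

theorem card_le_of_dvd_sub {S : Finset ℤ} {m : ℤ} (hm : 0 < m) {L : ℝ} (hL : 0 ≤ L)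
    (hdvd : ∀ x ∈ S, ∀ y ∈ S, m ∣ x - y) (hdiam : ∀ x ∈ S, ∀ y ∈ S, (x : ℝ) - y ≤ L) :
    (S.card : ℝ) ≤ L / m + 1 := by
  have hm' : (0 : ℝ) < m := by exact_mod_cast hm
  rcases S.eq_empty_or_nonempty with rfl | hS
  · simp only [Finset.card_empty, Nat.cast_zero]; positivity
  set a := S.min' hS
  have ha : a ∈ S := S.min'_mem hS
  have hcard : S.card ≤ (Finset.Icc 0 ⌊L / m⌋).card := by
    refine Finset.card_le_card_of_injOn (fun x => (x - a) / m) ?_ ?_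
    · intro x hx
      have hx0 : a ≤ x := S.min'_le x hx
      simp only [Finset.coe_Icc, Set.mem_Icc]
      refine ⟨Int.ediv_nonneg (by omega) hm.le, Int.le_floor.2 ?_⟩
      obtain ⟨c, hc⟩ := hdvd x hx a ha
      rw [hc, Int.mul_ediv_cancel_left _ hm.ne', le_div_iff₀ hm']
      have h1 := hdiam x hx a ha
      have h2 : (x : ℝ) - a = m * c := by exact_mod_cast hc
      linarith
    · intro x hx y hy hxy
      obtain ⟨c, hc⟩ := hdvd x hx a ha
      obtain ⟨e, he⟩ := hdvd y hy a ha
      simp only [hc, he, Int.mul_ediv_cancel_left _ hm.ne'] at hxy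
      subst hxy; omega
  have h0 : 0 ≤ ⌊L / m⌋ := Int.floor_nonneg.2 (by positivity)
  rw [Int.card_Icc] at hcard
  have h1 : (S.card : ℤ) ≤ ⌊L / m⌋ + 1 := by omega
  have h2 : (S.card : ℝ) ≤ ⌊L / m⌋ + 1 := by exact_mod_cast h1
  linarith [Int.floor_le (L / m)]

theorem card_le_mul_of_card_fiber_le {α β : Type*} [DecidableEq β] {S : Finset α} (f : α → β)
    {b n : ℝ} (hn : 0 ≤ n) (hb : ((S.image f).card : ℝ) ≤ b)
    (hfib : ∀ y ∈ S.image f, ((S.filter (fun x => f x = y)).card : ℝ) ≤ n) :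
    (S.card : ℝ) ≤ b * n := by
  rw [Finset.card_eq_sum_card_image f S, Nat.cast_sum]
  refine (Finset.sum_le_card_nsmul _ _ n hfib).trans ?_
  rw [nsmul_eq_mul]
  gcongr

/-- Integral triples `(d, w, v)` on which the quadratic form `d x² - 2 w x y + v y²` takes
a prescribed value `k` at a coprime pair `(p, q)`. -/
theorem card_le_of_value_eq {S : Finset (ℤ × ℤ × ℤ)} {p q k : ℤ} (hq : 0 < q)
    (hpq : IsCoprime p q) {U D : ℝ} (hU : 0 ≤ U) (hD : 0 ≤ D)
    (hk : ∀ F ∈ S, F.1 * p ^ 2 - 2 * F.2.1 * p * q + F.2.2 * q ^ 2 = k)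
    (hu : ∀ F ∈ S, |((F.1 * p - F.2.1 * q : ℤ) : ℝ)| ≤ U)
    (hd : ∀ F ∈ S, ∀ G ∈ S, F.1 * p - F.2.1 * q = G.1 * p - G.2.1 * q →
      (F.1 : ℝ) - G.1 ≤ D) :
    (S.card : ℝ) ≤ (2 * U / q + 1) * (D / (q : ℝ) ^ 2 + 1) := by
  have hq' : (0 : ℝ) < q := by exact_mod_cast hq
  refine card_le_mul_of_card_fiber_le (fun F => F.1 * p - F.2.1 * q) (by positivity) ?_ ?_
  · refine card_le_of_dvd_sub hq (by positivity) ?_ ?_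
    · simp only [Finset.mem_image]
      rintro _ ⟨F, hF, rfl⟩ _ ⟨G, hG, rfl⟩
      have h := (hk F hF).trans (hk G hG).symm
      refine hpq.symm.dvd_of_dvd_mul_left ⟨(F.2.1 - G.2.1) * p - (F.2.2 - G.2.2) * q, ?_⟩
      linear_combination h
    · simp only [Finset.mem_image]
      rintro _ ⟨F, hF, rfl⟩ _ ⟨G, hG, rfl⟩
      have h1 := abs_le.1 (hu F hF)
      have h2 := abs_le.1 (hu G hG)
      linarith
  · intro y _
    have key : ∀ F ∈ S, ∀ G ∈ S, F.1 * p - F.2.1 * q = G.1 * p - G.2.1 * q →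
        ∃ e, F.1 - G.1 = q ^ 2 * e ∧ F.2.1 - G.2.1 = p * q * e ∧ F.2.2 - G.2.2 = p ^ 2 * e := by
      intro F hF G hG h
      obtain ⟨e, he⟩ : q ∣ F.1 - G.1 :=
        hpq.symm.dvd_of_dvd_mul_left ⟨F.2.1 - G.2.1, by linear_combination h⟩
      have hw : F.2.1 - G.2.1 = p * e := by
        apply mul_left_cancel₀ hq.ne'
        linear_combination p * he - h
      have hv : (F.2.2 - G.2.2) * q = p ^ 2 * e := by
        apply mul_left_cancel₀ hq.ne'
        linear_combination hk F hF - hk G hG - p ^ 2 * he + 2 * p * q * hw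
      obtain ⟨e', rfl⟩ : q ∣ e :=
        (hpq.symm.pow_right (n := 2)).dvd_of_dvd_mul_left ⟨F.2.2 - G.2.2, by linear_combination -hv⟩
      refine ⟨e', by rw [he]; ring, by rw [hw]; ring, ?_⟩
      apply mul_left_cancel₀ hq.ne'
      linear_combination hv
    have hinj : Set.InjOn (fun F : ℤ × ℤ × ℤ => F.1)
        (S.filter (fun F => F.1 * p - F.2.1 * q = y)) := by
      intro F hF G hG h
      simp only [Finset.coe_filter, Set.mem_ofPred_eq] at hF hG h
      obtain ⟨e, h1, h2, h3⟩ := key F hF.1 G hG.1 (hF.2.trans hG.2.symm)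
      have he : e = 0 := by
        rcases mul_eq_zero.1 (h1.symm.trans (sub_eq_zero.2 h)) with h' | h'
        · exact absurd h' (pow_ne_zero 2 hq.ne')
        · exact h'
      subst he
      ext
      · exact h
      · linarith
      · linarith
    rw [← Finset.card_image_of_injOn hinj]
    have hq2 : ((q ^ 2 : ℤ) : ℝ) = (q : ℝ) ^ 2 := by push_cast; rfl
    rw [← hq2]
    refine card_le_of_dvd_sub (by positivity) hD ?_ ?_
    · simp only [Finset.mem_image, Finset.mem_filter]
      rintro _ ⟨F, hF, rfl⟩ _ ⟨G, hG, rfl⟩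
      obtain ⟨e, h1, -⟩ := key F hF.1 G hG.1 (hF.2.trans hG.2.symm)
      exact ⟨e, h1⟩
    · simp only [Finset.mem_image, Finset.mem_filter]
      rintro _ ⟨F, hF, rfl⟩ _ ⟨G, hG, rfl⟩
      exact hd F hF.1 G hG.1 (hF.2.trans hG.2.symm)

theorem sum_Icc_inv_sqrt_le (n : ℕ) : ∑ k ∈ Finset.Icc 1 n, 1 / √(k : ℝ) ≤ 2 * √n := by
  induction n with
  | zero => simp
  | succ n ih =>
    rw [Finset.sum_Icc_succ_top (by omega)]
    have h1 : (0 : ℝ) < √((n + 1 : ℕ) : ℝ) := Real.sqrt_pos.2 (by positivity)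
    have h2 : 0 ≤ √(n : ℝ) := Real.sqrt_nonneg _
    have h3 : √((n + 1 : ℕ) : ℝ) ^ 2 = n + 1 := by rw [Real.sq_sqrt (by positivity)]; push_cast; rfl
    have h4 : √(n : ℝ) ^ 2 = n := Real.sq_sqrt (by positivity)
    have h5 : 1 / √((n + 1 : ℕ) : ℝ) ≤ 2 * √((n + 1 : ℕ) : ℝ) - 2 * √n := by
      rw [div_le_iff₀ h1]
      nlinarith [sq_nonneg (√((n + 1 : ℕ) : ℝ) - √(n : ℝ))]
    linarith

/-- The number of `(d, w, v)` near the cone `d v = w²`, with `w / d` close to a given fraction and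
a given nonzero value at that fraction. -/
theorem card_le_of_value_ne_zero {S : Finset (ℤ × ℤ × ℤ)} {p q k : ℤ} (hq : 0 < q)
    (hpq : IsCoprime p q) {N h : ℝ} (hh : 1 ≤ h) (hqN : q ≤ N) (hk0 : k ≠ 0)
    (hk3 : |(k : ℝ)| ≤ 3 * h)
    (hk : ∀ F ∈ S, F.1 * p ^ 2 - 2 * F.2.1 * p * q + F.2.2 * q ^ 2 = k)
    (hdl : ∀ F ∈ S, N ^ 2 * h ≤ F.1) (hdu : ∀ F ∈ S, (F.1 : ℝ) ≤ 2 * (N ^ 2 * h))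
    (hm : ∀ F ∈ S, |((F.1 * F.2.2 - F.2.1 ^ 2 : ℤ) : ℝ)| ≤ h ^ 2) :
    (S.card : ℝ) ≤ 25 * N * h ^ 2 * √h / q * (1 / √|(k : ℝ)|) := by
  have hq1 : (1 : ℝ) ≤ q := by exact_mod_cast hq
  have hN : 1 ≤ N := hq1.trans hqN
  set κ : ℝ := |(k : ℝ)| with hκ
  have hκ1 : 1 ≤ κ := by
    rw [hκ]; exact_mod_cast Int.one_le_abs hk0
  have hkκ : (k : ℝ) ≤ κ := le_abs_self _
  have hid : ∀ F ∈ S, (F.1 : ℝ) * k = ((F.1 * p - F.2.1 * q : ℤ) : ℝ) ^ 2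
      + ((F.1 * F.2.2 - F.2.1 ^ 2 : ℤ) : ℝ) * q ^ 2 := by
    intro F hF
    rw [← hk F hF]; push_cast; ring
  have husq : ∀ F ∈ S, ((F.1 * p - F.2.1 * q : ℤ) : ℝ) ^ 2 ≤
      2 * (N ^ 2 * h) * κ + h ^ 2 * q ^ 2 := by
    intro F hF
    have h1 := hid F hF
    have h2 := (abs_le.1 (hm F hF)).1
    have h3 : (F.1 : ℝ) * k ≤ 2 * (N ^ 2 * h) * κ := by
      have : (0 : ℝ) ≤ F.1 := le_trans (by positivity) (hdl F hF)
      calc (F.1 : ℝ) * k ≤ F.1 * κ := by gcongr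
        _ ≤ _ := by gcongr; exact hdu F hF
    nlinarith [sq_nonneg (q : ℝ)]
  set sh := √h
  set sk := √κ
  have hsh : sh ^ 2 = h := Real.sq_sqrt (by positivity)
  have hsk : sk ^ 2 = κ := Real.sq_sqrt (by positivity)
  have hsh1 : 1 ≤ sh := Real.one_le_sqrt.2 hh
  have hsk1 : 1 ≤ sk := Real.one_le_sqrt.2 hκ1
  rcases le_or_gt (h * q ^ 2) (N ^ 2 * κ) with hcase | hcase
  · have hcard := card_le_of_value_eq hq hpq (S := S) (k := k) (U := 2 * N * (sh * sk))
      (D := 2 * h ^ 2 * q ^ 2 / κ) (by positivity) (by positivity) hk ?_ ?_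
    · refine hcard.trans ?_
      have e1 : 2 * (2 * N * (sh * sk)) / q + 1 ≤ 5 * N * (sh * sk) / q := by
        rw [div_add_one (by positivity)]
        gcongr
        have : 1 * 1 ≤ sh * sk := by gcongr
        nlinarith
      have e2 : 2 * h ^ 2 * q ^ 2 / κ / (q : ℝ) ^ 2 + 1 ≤ 5 * h ^ 2 / κ := by
        have : 2 * h ^ 2 * q ^ 2 / κ / (q : ℝ) ^ 2 = 2 * h ^ 2 / κ := by field_simp
        rw [this, div_add_one (by positivity)]
        gcongr
        nlinarith
      calc _ ≤ (5 * N * (sh * sk) / q) * (5 * h ^ 2 / κ) := by gcongr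
        _ = _ := by rw [← hsk]; field_simp; ring
    · intro F hF
      refine abs_le_of_sq_le_sq ?_ (by positivity)
      have : (2 * N * (sh * sk)) ^ 2 = 4 * N ^ 2 * h * κ := by rw [← hsh, ← hsk]; ring
      rw [this]
      nlinarith [husq F hF]
    · intro F hF G hG hFG
      rw [le_div_iff₀ (by positivity)]
      have h1 := hid F hF
      have h2 := hid G hG
      rw [hFG] at h1
      have h3 := abs_le.1 (hm F hF)
      have h4 := abs_le.1 (hm G hG)
      calc ((F.1 : ℝ) - G.1) * κ ≤ |((F.1 : ℝ) - G.1) * k| := by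
            rw [abs_mul]; gcongr; exact le_abs_self _
        _ = |((F.1 * F.2.2 - F.2.1 ^ 2 : ℤ) : ℝ) - ((G.1 * G.2.2 - G.2.1 ^ 2 : ℤ) : ℝ)|
              * q ^ 2 := by
            rw [sub_mul, h1, h2, ← abs_of_nonneg (sq_nonneg (q : ℝ)), ← abs_mul,
              abs_of_nonneg (sq_nonneg (q : ℝ))]
            congr 1; ring
        _ ≤ 2 * h ^ 2 * q ^ 2 := by
            gcongr
            rw [abs_le]; constructor <;> linarith
  · have hcard := card_le_of_value_eq hq hpq (S := S) (k := k) (U := 2 * h * q)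
      (D := N ^ 2 * h) (by positivity) (by positivity) hk ?_ ?_
    · refine hcard.trans ?_
      have e1 : 2 * (2 * h * q) / q + 1 ≤ 5 * h := by
        have : 2 * (2 * h * q) / q = 4 * h := by field_simp; ring
        linarith
      have hqq : (q : ℝ) ^ 2 ≤ N ^ 2 * h := by nlinarith
      have e2 : N ^ 2 * h / (q : ℝ) ^ 2 + 1 ≤ 2 * N ^ 2 * h / q ^ 2 := by
        rw [div_add_one (by positivity)]
        gcongr
        linarith
      have e3 : N * sk ≤ sh * q := by
        refine le_of_sq_le_sq ?_ (by positivity)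
        nlinarith
      calc _ ≤ (5 * h) * (2 * N ^ 2 * h / q ^ 2) := by gcongr
        _ = 10 * N * h ^ 2 / (q ^ 2 * sk) * (N * sk) := by field_simp; ring
        _ ≤ 10 * N * h ^ 2 / (q ^ 2 * sk) * (sh * q) := by gcongr
        _ = 10 * (N * h ^ 2 * sh / q * (1 / sk)) := by field_simp
        _ ≤ 25 * (N * h ^ 2 * sh / q * (1 / sk)) := by gcongr; norm_num
        _ = _ := by ring
    · intro F hF
      refine abs_le_of_sq_le_sq ?_ (by positivity)
      nlinarith [husq F hF]
    · intro F hF G hG _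
      linarith [hdu F hF, hdl G hG]

theorem card_le_of_value_eq_zero {S : Finset (ℤ × ℤ × ℤ)} {p q : ℤ} (hq : 0 < q)
    (hpq : IsCoprime p q) {N h : ℝ} (hh : 1 ≤ h) (hqN : q ≤ N)
    (hk : ∀ F ∈ S, F.1 * p ^ 2 - 2 * F.2.1 * p * q + F.2.2 * q ^ 2 = 0)
    (hdl : ∀ F ∈ S, N ^ 2 * h ≤ F.1) (hdu : ∀ F ∈ S, (F.1 : ℝ) ≤ 2 * (N ^ 2 * h))
    (hm : ∀ F ∈ S, |((F.1 * F.2.2 - F.2.1 ^ 2 : ℤ) : ℝ)| ≤ h ^ 2) :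
    (S.card : ℝ) ≤ 6 * N ^ 2 * h ^ 2 / q ^ 2 := by
  have hq1 : (1 : ℝ) ≤ q := by exact_mod_cast hq
  have hN : 1 ≤ N := hq1.trans hqN
  have hcard := card_le_of_value_eq hq hpq (S := S) (k := 0) (U := h * q)
    (D := N ^ 2 * h) (by positivity) (by positivity) hk ?_ ?_
  · refine hcard.trans ?_
    have e1 : 2 * (h * q) / q + 1 ≤ 3 * h := by
      have : 2 * (h * q) / q = 2 * h := by field_simp
      linarith
    have hqq : (q : ℝ) ^ 2 ≤ N ^ 2 * h := by nlinarith
    have e2 : N ^ 2 * h / (q : ℝ) ^ 2 + 1 ≤ 2 * N ^ 2 * h / q ^ 2 := by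
      rw [div_add_one (by positivity)]
      gcongr
      linarith
    calc _ ≤ (3 * h) * (2 * N ^ 2 * h / q ^ 2) := by gcongr
      _ = _ := by ring
  · intro F hF
    refine abs_le_of_sq_le_sq ?_ (by positivity)
    have hid : (F.1 : ℝ) * (0 : ℤ) = ((F.1 * p - F.2.1 * q : ℤ) : ℝ) ^ 2
        + ((F.1 * F.2.2 - F.2.1 ^ 2 : ℤ) : ℝ) * q ^ 2 := by
      rw [← hk F hF]; push_cast; ring
    have h2 := (abs_le.1 (hm F hF)).1
    push_cast at hid h2 ⊢
    nlinarith [sq_nonneg (q : ℝ)]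
  · intro F hF G hG _
    linarith [hdu F hF, hdl G hG]

/-- The number of `(d, w, v)` near the cone `d v = w²` with `w / d` in the Farey arc around
`p / q`. -/
theorem card_le_of_near_fraction {S : Finset (ℤ × ℤ × ℤ)} {p q : ℤ} (hq : 0 < q)
    (hpq : IsCoprime p q) {N h : ℝ} (hh : 1 ≤ h) (hqN : q ≤ N)
    (hu : ∀ F ∈ S, |((F.1 * p - F.2.1 * q : ℤ) : ℝ)| ≤ F.1 / N)
    (hdl : ∀ F ∈ S, N ^ 2 * h ≤ F.1) (hdu : ∀ F ∈ S, (F.1 : ℝ) ≤ 2 * (N ^ 2 * h))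
    (hm : ∀ F ∈ S, |((F.1 * F.2.2 - F.2.1 ^ 2 : ℤ) : ℝ)| ≤ h ^ 2) :
    (S.card : ℝ) ≤ 6 * N ^ 2 * h ^ 2 / q ^ 2 + 200 * N * h ^ 3 / q := by
  have hq1 : (1 : ℝ) ≤ q := by exact_mod_cast hq
  have hN : 1 ≤ N := hq1.trans hqN
  set val : ℤ × ℤ × ℤ → ℤ := fun F => F.1 * p ^ 2 - 2 * F.2.1 * p * q + F.2.2 * q ^ 2 with hval
  have hid : ∀ F : ℤ × ℤ × ℤ, (F.1 : ℝ) * val F = ((F.1 * p - F.2.1 * q : ℤ) : ℝ) ^ 2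
      + ((F.1 * F.2.2 - F.2.1 ^ 2 : ℤ) : ℝ) * q ^ 2 := by
    intro F
    simp only [hval]; push_cast; ring
  have hbound : ∀ F ∈ S, |(val F : ℝ)| ≤ 3 * h := by
    intro F hF
    have hd0 : (0 : ℝ) < F.1 := lt_of_lt_of_le (by positivity) (hdl F hF)
    have h1 : ((F.1 * p - F.2.1 * q : ℤ) : ℝ) ^ 2 ≤ F.1 * (2 * h) := by
      calc _ ≤ ((F.1 : ℝ) / N) ^ 2 := sq_le_sq' (abs_le.1 (hu F hF)).1 (abs_le.1 (hu F hF)).2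
        _ = F.1 * (F.1 / N ^ 2) := by ring
        _ ≤ _ := by
          gcongr
          rw [div_le_iff₀ (by positivity)]
          linarith [hdu F hF]
    have h2 : |((F.1 * F.2.2 - F.2.1 ^ 2 : ℤ) : ℝ) * q ^ 2| ≤ F.1 * h := by
      rw [abs_mul, abs_of_nonneg (sq_nonneg (q : ℝ))]
      calc _ ≤ h ^ 2 * N ^ 2 := by gcongr; exact hm F hF
        _ = (N ^ 2 * h) * h := by ring
        _ ≤ _ := by gcongr; exact hdl F hF
    have h3 : F.1 * |(val F : ℝ)| ≤ F.1 * (3 * h) := by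
      rw [← abs_of_pos hd0, ← abs_mul, abs_of_pos hd0, hid F]
      refine (abs_add_le _ _).trans ?_
      rw [abs_of_nonneg (sq_nonneg _)]
      linarith
    exact le_of_mul_le_mul_left h3 hd0
  set M : ℕ := ⌊3 * h⌋₊
  have hmaps : ∀ F ∈ S, (val F).natAbs ∈ Finset.Icc 0 M := by
    intro F hF
    rw [Finset.mem_Icc]
    refine ⟨Nat.zero_le _, Nat.le_floor ?_⟩
    rw [Nat.cast_natAbs, Int.cast_abs]
    exact hbound F hF
  have hpt : ∀ k : ℤ, k ≠ 0 → |(k : ℝ)| ≤ 3 * h →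
      ((S.filter (fun F => val F = k)).card : ℝ) ≤ 25 * N * h ^ 2 * √h / q * (1 / √|(k : ℝ)|) := by
    intro k hk0 hk3
    refine card_le_of_value_ne_zero hq hpq hh hqN hk0 hk3 ?_ ?_ ?_ ?_ <;> intro F hF <;>
      rw [Finset.mem_filter] at hF
    exacts [hF.2, hdl F hF.1, hdu F hF.1, hm F hF.1]
  have hzero : ((S.filter (fun F => (val F).natAbs = 0)).card : ℝ) ≤
      6 * N ^ 2 * h ^ 2 / q ^ 2 := by
    refine card_le_of_value_eq_zero hq hpq hh hqN ?_ ?_ ?_ ?_ <;> intro F hF <;>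
      rw [Finset.mem_filter] at hF
    exacts [Int.natAbs_eq_zero.1 hF.2, hdl F hF.1, hdu F hF.1, hm F hF.1]
  have hpos : ∀ k ∈ Finset.Icc 1 M, ((S.filter (fun F => (val F).natAbs = k)).card : ℝ) ≤
      50 * N * h ^ 2 * √h / q * (1 / √(k : ℝ)) := by
    intro k hk
    rw [Finset.mem_Icc] at hk
    have hk3 : (k : ℝ) ≤ 3 * h := (Nat.le_floor_iff (by positivity)).1 hk.2
    have hsub : S.filter (fun F => (val F).natAbs = k) ⊆
        S.filter (fun F => val F = (k : ℤ)) ∪ S.filter (fun F => val F = -(k : ℤ)) := by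
      intro F hF
      simp only [Finset.mem_filter, Finset.mem_union] at hF ⊢
      rcases Int.natAbs_eq_iff.1 hF.2 with h' | h'
      exacts [Or.inl ⟨hF.1, h'⟩, Or.inr ⟨hF.1, h'⟩]
    have hle : ((S.filter (fun F => (val F).natAbs = k)).card : ℝ) ≤
        (S.filter (fun F => val F = (k : ℤ))).card + (S.filter (fun F => val F = -(k : ℤ))).card := by
      exact_mod_cast (Finset.card_le_card hsub).trans (Finset.card_union_le _ _)
    have h1 := hpt k (by omega) (by simpa using hk3)
    have h2 := hpt (-k) (by omega) (by simpa using hk3)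
    simp only [Int.cast_neg, abs_neg, Int.cast_natCast, Nat.abs_cast] at h1 h2
    calc _ ≤ _ := hle
      _ ≤ 25 * N * h ^ 2 * √h / q * (1 / √(k : ℝ)) + 25 * N * h ^ 2 * √h / q * (1 / √(k : ℝ)) :=
        add_le_add h1 h2
      _ = _ := by ring
  rw [Finset.card_eq_sum_card_fiberwise hmaps, Nat.cast_sum,
    ← Finset.add_sum_Ioc_eq_sum_Icc (Nat.zero_le M)]
  refine add_le_add hzero ?_
  have hIoc : Finset.Ioc 0 M = Finset.Icc 1 M := rfl
  rw [hIoc]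
  calc _ ≤ ∑ k ∈ Finset.Icc 1 M, 50 * N * h ^ 2 * √h / q * (1 / √(k : ℝ)) := Finset.sum_le_sum hpos
    _ = 50 * N * h ^ 2 * √h / q * ∑ k ∈ Finset.Icc 1 M, 1 / √(k : ℝ) := by rw [Finset.mul_sum]
    _ ≤ 50 * N * h ^ 2 * √h / q * (2 * √M) := by gcongr; exact sum_Icc_inv_sqrt_le M
    _ ≤ 50 * N * h ^ 2 * √h / q * (2 * (2 * √h)) := by
      gcongr
      rw [show (2 : ℝ) = √4 by rw [show (4 : ℝ) = 2 ^ 2 by norm_num]; simp,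
        ← Real.sqrt_mul (by norm_num)]
      refine Real.sqrt_le_sqrt ((Nat.floor_le (by positivity)).trans (by linarith))
    _ = 200 * N * h ^ 2 * (√h) ^ 2 / q := by ring
    _ = _ := by rw [Real.sq_sqrt (by positivity)]; ring

/-- The number of integral `(d, w, v)` of size about `X = N² h` with `|d v - w²| ≤ h²` is
`O(X h²)`. -/
theorem card_near_cone_le {S : Finset (ℤ × ℤ × ℤ)} {N h T : ℝ} (hh : 1 ≤ h) (hN : 1 ≤ N)
    (hlog : 1 + Real.log N ≤ h) (hT : 0 ≤ T) (hw : ∀ F ∈ S, |(F.2.1 : ℝ)| ≤ T * F.1)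
    (hdl : ∀ F ∈ S, N ^ 2 * h ≤ F.1) (hdu : ∀ F ∈ S, (F.1 : ℝ) ≤ 2 * (N ^ 2 * h))
    (hm : ∀ F ∈ S, |((F.1 * F.2.2 - F.2.1 ^ 2 : ℤ) : ℝ)| ≤ h ^ 2) :
    (S.card : ℝ) ≤ 206 * (2 * T + 3) * (N ^ 2 * h ^ 3) := by
  have hfl : 0 < ⌊N⌋₊ := Nat.floor_pos.2 hN
  have hex : ∀ F : ℤ × ℤ × ℤ, ∃ r : ℚ,
      |(F.2.1 : ℝ) / F.1 - r| ≤ 1 / (N * r.den) ∧ r.den ≤ ⌊N⌋₊ := by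
    intro F
    obtain ⟨r, h1, h2⟩ := Real.exists_rat_abs_sub_le_and_den_le ((F.2.1 : ℝ) / F.1) hfl
    have hr : (0 : ℝ) < r.den := by exact_mod_cast r.den_pos
    refine ⟨r, h1.trans ?_, h2⟩
    gcongr
    exact (Nat.lt_floor_add_one N).le
  choose φ hφ1 hφ2 using hex
  have hd0 : ∀ F ∈ S, (0 : ℝ) < F.1 := fun F hF => lt_of_lt_of_le (by positivity) (hdl F hF)
  have hfrac : ∀ r : ℚ, r.den ≤ ⌊N⌋₊ → ((S.filter (fun F => φ F = r)).card : ℝ) ≤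
      6 * N ^ 2 * h ^ 2 / r.den ^ 2 + 200 * N * h ^ 3 / r.den := by
    intro r hr
    have hr0 : (0 : ℝ) < r.den := by exact_mod_cast r.den_pos
    have := card_le_of_near_fraction (S := S.filter (fun F => φ F = r)) (p := r.num)
      (q := (r.den : ℤ)) (N := N) (h := h) (by exact_mod_cast r.den_pos)
      (Int.isCoprime_iff_gcd_eq_one.2 r.reduced) hh
      (by exact_mod_cast (Nat.le_floor_iff (by positivity)).1 hr) ?_ ?_ ?_ ?_
    · simpa using this
    all_goals intro F hF; rw [Finset.mem_filter] at hF
    · have h1 := hφ1 F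
      rw [hF.2, Rat.cast_def] at h1
      have hF0 := hd0 F hF.1
      have e : ((F.1 * r.num - F.2.1 * r.den : ℤ) : ℝ) =
          -(F.1 * r.den * ((F.2.1 : ℝ) / F.1 - r.num / r.den)) := by
        push_cast; field_simp; ring
      rw [e, abs_neg, abs_mul, abs_of_pos (by positivity)]
      calc _ ≤ (F.1 : ℝ) * r.den * (1 / (N * r.den)) := by gcongr
        _ = _ := by field_simp
    · exact hdl F hF.1
    · exact hdu F hF.1
    · exact hm F hF.1
  have hmaps : ∀ F ∈ S, (φ F).den ∈ Finset.Icc 1 ⌊N⌋₊ := fun F _ =>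
    Finset.mem_Icc.2 ⟨(φ F).den_pos, hφ2 F⟩
  have hden : ∀ q ∈ Finset.Icc 1 ⌊N⌋₊, ((S.filter (fun F => (φ F).den = q)).card : ℝ) ≤
      (2 * T + 3) * (6 * N ^ 2 * h ^ 2 * (q : ℝ)⁻¹ + 200 * N * h ^ 3) := by
    intro q hq
    rw [Finset.mem_Icc] at hq
    have hq1 : (1 : ℝ) ≤ q := by exact_mod_cast hq.1
    have := card_le_mul_of_card_fiber_le (S := S.filter (fun F => (φ F).den = q)) φ
      (b := (2 * T + 3) * q) (n := 6 * N ^ 2 * h ^ 2 / q ^ 2 + 200 * N * h ^ 3 / q)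
      (by positivity) ?_ ?_
    · refine this.trans (le_of_eq ?_)
      field_simp
    · have hinj : Set.InjOn (fun r : ℚ => r.num) ((S.filter (fun F => (φ F).den = q)).image φ) := by
        intro r hr r' hr' hrr
        simp only [Finset.coe_image, Finset.coe_filter, Set.mem_image, Set.mem_ofPred_eq] at hr hr'
        obtain ⟨F, hF, rfl⟩ := hr
        obtain ⟨G, hG, rfl⟩ := hr'
        exact Rat.ext hrr (hF.2.trans hG.2.symm)
      rw [← Finset.card_image_of_injOn hinj]
      have hnum : ∀ x : ℤ, x ∈ ((S.filter (fun F => (φ F).den = q)).image φ).image (fun r => r.num) →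
          |(x : ℝ)| ≤ (T + 1) * q := by
        simp only [Finset.mem_image, Finset.mem_filter]
        rintro _ ⟨_, ⟨F, ⟨hF, hFq⟩, rfl⟩, rfl⟩
        have h1 := hφ1 F
        rw [hFq] at h1
        have h2 : |(F.2.1 : ℝ) / F.1| ≤ T := by
          rw [abs_div, abs_of_pos (hd0 F hF), div_le_iff₀ (hd0 F hF)]
          exact hw F hF
        have h3 : 1 / (N * q) ≤ 1 := by
          rw [div_le_one (by positivity)]
          nlinarith
        have h4 : |((φ F : ℚ) : ℝ)| ≤ T + 1 := by
          have := abs_sub_abs_le_abs_sub ((φ F : ℚ) : ℝ) ((F.2.1 : ℝ) / F.1)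
          rw [abs_sub_comm] at this
          linarith
        rw [Rat.cast_def, hFq, abs_div, Nat.abs_cast, div_le_iff₀ (by positivity)] at h4
        exact h4
      have := card_le_of_dvd_sub (m := 1) (L := 2 * (T + 1) * q) one_pos (by positivity)
        (fun x _ y _ => one_dvd _) (fun x hx y hy => ?_) (S :=
          ((S.filter (fun F => (φ F).den = q)).image φ).image (fun r => r.num))
      · refine this.trans ?_
        simp only [Int.cast_one, div_one]
        linarith
      · have h1 := abs_le.1 (hnum x hx)
        have h2 := abs_le.1 (hnum y hy)
        linarith
    · intro r hr
      simp only [Finset.mem_image, Finset.mem_filter] at hr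
      obtain ⟨F, ⟨hF, hFq⟩, rfl⟩ := hr
      have := hfrac (φ F) (hφ2 F)
      rw [hFq] at this
      refine le_trans ?_ this
      gcongr
      exact Finset.filter_subset _ _
  have hharm : ∑ q ∈ Finset.Icc 1 ⌊N⌋₊, ((q : ℝ))⁻¹ ≤ h := by
    have h1 := harmonic_le_one_add_log ⌊N⌋₊
    rw [harmonic_eq_sum_Icc] at h1
    push_cast at h1
    refine h1.trans (le_trans ?_ hlog)
    gcongr
    exact Nat.floor_le (by positivity)
  rw [Finset.card_eq_sum_card_fiberwise hmaps, Nat.cast_sum]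
  refine (Finset.sum_le_sum hden).trans ?_
  rw [← Finset.mul_sum, Finset.sum_add_distrib, ← Finset.mul_sum, Finset.sum_const, Nat.card_Icc,
    nsmul_eq_mul, Nat.add_sub_cancel]
  have hflN : (⌊N⌋₊ : ℝ) ≤ N := Nat.floor_le (by positivity)
  calc _ ≤ (2 * T + 3) * (6 * N ^ 2 * h ^ 2 * h + N * (200 * N * h ^ 3)) := by gcongr
    _ = _ := by ring

theorem hausdorffMeasure_limsup_eq_zero {ι X : Type*} [Countable ι] [EMetricSpace X]
    [MeasurableSpace X] [BorelSpace X] {s : ℝ} (hs : 0 < s) (B : ι → Set X)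
    (hB : ∑' i, Metric.ediam (B i) ^ s ≠ ⊤) :
    μH[s] {x | {i | x ∈ B i}.Infinite} = 0 := by
  have htail := ENNReal.tendsto_tsum_compl_atTop_zero hB
  refine le_antisymm ?_ zero_le
  refine (Measure.hausdorffMeasure_le_liminf_tsum (l := atTop) (β := Finset ι)
    (ι := fun A => {i // i ∉ A}) s _
    (fun A => (∑' i : {i // i ∉ A}, Metric.ediam (B i) ^ s) ^ s⁻¹) ?_
    (fun A i => B i) ?_ ?_).trans htail.liminf_eq.le
  · have := (ENNReal.continuous_rpow_const (y := s⁻¹)).tendsto 0 |>.comp htail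
    rwa [ENNReal.zero_rpow_of_pos (inv_pos.2 hs)] at this
  · refine Eventually.of_forall fun A i => ?_
    rw [ENNReal.le_rpow_inv_iff hs]
    exact ENNReal.le_tsum (f := fun i : {i // i ∉ A} => Metric.ediam (B i) ^ s) i
  · refine Eventually.of_forall fun A x hx => ?_
    obtain ⟨i, hi, hiA⟩ := Set.Infinite.exists_notMem_finset hx A
    exact Set.mem_iUnion.2 ⟨⟨i, hiA⟩, hi⟩

/-- The `t ∈ [-T, T]` such that `(t, t²)` is within `δ n / d` of infinitely many rational points
with denominator `d` in a dyadic range `[2ⁿ, 2ⁿ⁺¹)`. -/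
def parabolaApprox (δ : ℕ → ℝ) (T : ℝ) : Set ℝ :=
  {t | |t| ≤ T ∧ {n : ℕ | ∃ d w v : ℤ, (2 : ℝ) ^ n ≤ d ∧ (d : ℝ) < 2 ^ (n + 1) ∧
    |d * t - w| ≤ δ n ∧ |d * t ^ 2 - v| ≤ δ n}.Infinite}

theorem card_near_cone_dyadic_le {S : Finset (ℤ × ℤ × ℤ)} {n : ℕ} {H T : ℝ}
    (hH : (n + 1 : ℝ) ^ 2 ≤ H) (hH' : H ≤ 4 ^ n) (hT : 0 ≤ T)
    (hw : ∀ F ∈ S, |(F.2.1 : ℝ)| ≤ T * F.1)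
    (hdl : ∀ F ∈ S, (2 : ℝ) ^ n ≤ F.1) (hdu : ∀ F ∈ S, (F.1 : ℝ) ≤ 2 * 2 ^ n)
    (hm : ∀ F ∈ S, |((F.1 * F.2.2 - F.2.1 ^ 2 : ℤ) : ℝ)| ≤ H) :
    (S.card : ℝ) ≤ 206 * (2 * T + 3) * (2 ^ n * H) := by
  have hH0 : 0 ≤ H := le_trans (by positivity) hH
  have hh : (n + 1 : ℝ) ≤ √H := Real.le_sqrt_of_sq_le hH
  have hh1 : 1 ≤ √H := le_trans (by simp) hh
  have hsq : √H ^ 2 = H := Real.sq_sqrt hH0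
  have hle : √H ≤ 2 ^ n := by
    rw [Real.sqrt_le_left (by positivity), ← pow_mul, mul_comm, pow_mul]
    norm_num [hH']
  have hN2 : √(2 ^ n / √H) ^ 2 * √H = 2 ^ n := by
    rw [Real.sq_sqrt (by positivity)]; field_simp
  have hN1 : 1 ≤ √(2 ^ n / √H) := by
    rw [Real.one_le_sqrt, one_le_div (by positivity)]; exact hle
  have hlog : 1 + Real.log √(2 ^ n / √H) ≤ √H := by
    have h1 : Real.log (2 ^ n / √H) ≤ n := by
      calc Real.log (2 ^ n / √H) ≤ Real.log (2 ^ n) := by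
            apply Real.log_le_log (by positivity)
            exact div_le_self (by positivity) hh1
        _ = n * Real.log 2 := Real.log_pow _ _
        _ ≤ n * 1 := by gcongr; linarith [Real.log_two_lt_d9]
        _ = n := mul_one _
    rw [Real.log_sqrt (by positivity)]
    have : (0 : ℝ) ≤ n := by positivity
    linarith
  have := card_near_cone_le (S := S) hh1 hN1 hlog hT hw (by rwa [hN2]) (by rwa [hN2])
    (by rwa [hsq])
  have e : √(2 ^ n / √H) ^ 2 * √H ^ 3 = 2 ^ n * H := by
    rw [pow_succ √H 2, hsq, mul_comm H, ← mul_assoc, hN2]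
  rwa [e] at this

theorem summable_cover_sizes {s : ℝ} (hs : s ∈ Set.Ioo (1 / 2 : ℝ) 1) {δ : ℕ → ℝ}
    (hδ0 : ∀ n, 0 ≤ δ n) (hδ : Summable fun n : ℕ => ((2 : ℝ) ^ n) ^ (2 - s) * δ n ^ (s + 1))
    {C : ℝ} (hC : 0 ≤ C) :
    Summable fun n : ℕ => (2 : ℝ) ^ n * (C * (2 ^ n * δ n) + (n + 1) ^ 2) *
      (2 * ((C * (2 ^ n * δ n) + (n + 1) ^ 2) / 4 ^ n)) ^ s := by
  obtain ⟨hs1, hs2⟩ := hs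
  set ρ : ℝ := 2 ^ (1 - 2 * s) with hρ
  have hρ0 : 0 < ρ := by positivity
  have hρ1 : ρ < 1 := Real.rpow_lt_one_of_one_lt_of_neg (by norm_num) (by linarith)
  have hgeo : Summable fun n : ℕ => ((n : ℝ) + 1) ^ 4 * ρ ^ n := by
    have h1 := summable_pow_mul_geometric_of_norm_lt_one 4 (r := ρ)
      (by rwa [Real.norm_of_nonneg hρ0.le])
    have h2 := ((summable_nat_add_iff 1).2 h1).mul_right ρ⁻¹
    refine h2.congr fun n => ?_
    push_cast
    rw [pow_succ ρ]
    field_simp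
  refine Summable.of_nonneg_of_le (fun n => ?_) (fun n => ?_)
    ((hδ.mul_left (4 * C ^ (s + 1))).add (hgeo.mul_left 4))
  · have := hδ0 n
    positivity
  · have hδn := hδ0 n
    set x : ℝ := 2 ^ n with hx
    have hx0 : 0 < x := by positivity
    set b : ℝ := (n + 1) ^ 2 with hb
    have hb1 : 1 ≤ b := by
      rw [hb]; exact one_le_pow₀ (by simp)
    set H := C * (x * δ n) + b with hH
    have hH0 : 0 < H := by positivity
    have h4 : (4 : ℝ) ^ n = x ^ (2 : ℝ) := by
      rw [hx, Real.rpow_two, ← pow_mul, mul_comm, pow_mul]; norm_num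
    have hρn : ρ ^ n = x ^ (1 - 2 * s) := by
      rw [hρ, hx, ← Real.rpow_natCast, ← Real.rpow_mul (by norm_num), mul_comm,
        Real.rpow_mul (by norm_num), Real.rpow_natCast]
    have hHs : H ^ (s + 1) ≤ 2 * (C ^ (s + 1) * (x ^ (s + 1) * δ n ^ (s + 1)) + b ^ 2) := by
      have h1 : (C * (x * δ n) + b) ^ (s + 1) ≤
          2 ^ (s + 1 - 1) * ((C * (x * δ n)) ^ (s + 1) + b ^ (s + 1)) := by
        exact_mod_cast NNReal.rpow_add_le_mul_rpow_add_rpow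
          ⟨C * (x * δ n), by positivity⟩ ⟨b, by positivity⟩ (p := s + 1) (by linarith)
      have h2 : (2 : ℝ) ^ (s + 1 - 1) ≤ 2 := by
        calc (2 : ℝ) ^ (s + 1 - 1) ≤ 2 ^ (1 : ℝ) :=
              Real.rpow_le_rpow_of_exponent_le (by norm_num) (by linarith)
          _ = 2 := Real.rpow_one _
      have h3 : b ^ (s + 1) ≤ b ^ 2 := by
        rw [← Real.rpow_two]
        exact Real.rpow_le_rpow_of_exponent_le hb1 (by linarith)
      rw [Real.mul_rpow hC (by positivity), Real.mul_rpow hx0.le hδn] at h1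
      calc _ ≤ _ := h1
        _ ≤ _ := by gcongr
    have h2s : (2 : ℝ) ^ s ≤ 2 := by
      calc (2 : ℝ) ^ s ≤ 2 ^ (1 : ℝ) :=
            Real.rpow_le_rpow_of_exponent_le (by norm_num) hs2.le
        _ = 2 := Real.rpow_one _
    have hb4 : b ^ 2 = ((n : ℝ) + 1) ^ 4 := by rw [hb]; ring
    calc x * H * (2 * (H / 4 ^ n)) ^ s = 2 ^ s * (x ^ (1 - 2 * s) * H ^ (s + 1)) := by
          rw [h4, Real.mul_rpow (by norm_num) (by positivity), Real.div_rpow hH0.le (by positivity),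
            ← Real.rpow_mul hx0.le, Real.rpow_sub hx0, Real.rpow_add_one hH0.ne', Real.rpow_one]
          ring
      _ ≤ 2 * (x ^ (1 - 2 * s) * (2 * (C ^ (s + 1) * (x ^ (s + 1) * δ n ^ (s + 1)) + b ^ 2))) := by
          gcongr
      _ = 4 * C ^ (s + 1) * (x ^ (2 - s) * δ n ^ (s + 1)) + 4 * (((n : ℝ) + 1) ^ 4 * ρ ^ n) := by
          rw [hρn, ← hb4, show 2 - s = (1 - 2 * s) + (s + 1) by ring,
            Real.rpow_add hx0 (1 - 2 * s) (s + 1)]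
          ring

theorem hausdorffMeasure_parabolaApprox {s : ℝ} (hs : s ∈ Set.Ioo (1 / 2 : ℝ) 1) {δ : ℕ → ℝ}
    (hδ0 : ∀ n, 0 ≤ δ n) (hδ : Summable fun n : ℕ => ((2 : ℝ) ^ n) ^ (2 - s) * δ n ^ (s + 1))
    {T : ℝ} (hT : 0 ≤ T) : μH[s] (parabolaApprox δ T) = 0 := by
  have hs0 : 0 < s := by linarith [hs.1]
  set C : ℝ := 4 * T + 4 with hCdef
  have hC : 0 ≤ C := by positivity
  set H : ℕ → ℝ := fun n => C * (2 ^ n * δ n) + (n + 1) ^ 2 with hHdef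
  have hH0 : ∀ n, 0 ≤ H n := fun n => by have := hδ0 n; positivity
  have hHn : ∀ n : ℕ, ((n : ℝ) + 1) ^ 2 ≤ H n := fun n => by
    have := hδ0 n
    exact le_add_of_nonneg_left (by positivity)
  have hsmall : ∀ᶠ n in atTop, δ n ≤ 1 := by
    filter_upwards [hδ.tendsto_atTop_zero.eventually (gt_mem_nhds one_pos)] with n hn
    by_contra! h
    refine absurd hn (not_lt.2 ?_)
    exact one_le_mul_of_one_le_of_one_le
      (Real.one_le_rpow (one_le_pow₀ (by norm_num)) (by linarith [hs.2]))
      (Real.one_le_rpow h.le (by linarith))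
  have hlarge : ∀ᶠ n : ℕ in atTop, C + 6 ≤ (2 : ℝ) ^ n :=
    (tendsto_pow_atTop_atTop_of_one_lt (by norm_num)).eventually_ge_atTop _
  obtain ⟨n₀, hn₀⟩ := eventually_atTop.1 (hsmall.and hlarge)
  have hsq : ∀ n : ℕ, ((n : ℝ) ^ 2 + 4 * n + 6) ≤ 6 * 2 ^ n := by
    intro n
    induction n with
    | zero => norm_num
    | succ n ih => rw [pow_succ (2 : ℝ)]; push_cast; nlinarith [sq_nonneg (n : ℝ)]
  have hH4 : ∀ n, n₀ ≤ n → H n ≤ 4 ^ n := by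
    intro n hn
    obtain ⟨h1, h2⟩ := hn₀ n hn
    have h3 : (4 : ℝ) ^ n = 2 ^ n * 2 ^ n := by rw [← mul_pow]; norm_num
    have h4 : C * (2 ^ n * δ n) ≤ C * (2 ^ n * 1) := by gcongr
    have h5 : (0 : ℝ) < 2 ^ n := by positivity
    have h6 : (0 : ℝ) ≤ n := by positivity
    calc H n ≤ C * (2 ^ n * 1) + 6 * 2 ^ n := by
          refine add_le_add h4 ?_
          nlinarith [hsq n]
      _ = (C + 6) * 2 ^ n := by ring
      _ ≤ _ := by rw [h3]; gcongr
  set G : ℕ → Set (ℤ × ℤ × ℤ) := fun n => {F | n₀ ≤ n ∧ |(F.2.1 : ℝ)| ≤ (T + 1) * F.1 ∧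
    (2 : ℝ) ^ n ≤ F.1 ∧ (F.1 : ℝ) ≤ 2 * 2 ^ n ∧
    |((F.1 * F.2.2 - F.2.1 ^ 2 : ℤ) : ℝ)| ≤ H n} with hG
  set B : (Σ n, G n) → Set ℝ := fun i =>
    Set.Icc ((i.2.1.2.1 : ℝ) / i.2.1.1 - H i.1 / 4 ^ i.1)
      ((i.2.1.2.1 : ℝ) / i.2.1.1 + H i.1 / 4 ^ i.1) with hBdef
  have hsum := (summable_cover_sizes hs hδ0 hδ hC).mul_left (206 * (2 * (T + 1) + 3))
  have hB : ∑' i, Metric.ediam (B i) ^ s ≠ ⊤ := by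
    rw [ENNReal.tsum_sigma']
    refine ne_top_of_le_ne_top hsum.tsum_ofReal_ne_top (ENNReal.tsum_le_tsum fun n => ?_)
    have hdiam : ∀ F : G n, Metric.ediam (B ⟨n, F⟩) ^ s =
        ENNReal.ofReal ((2 * (H n / 4 ^ n)) ^ s) := by
      intro F
      have := hH0 n
      simp only [hBdef, Real.ediam_Icc]
      rw [ENNReal.ofReal_rpow_of_nonneg _ hs0.le]
      · congr 2; ring
      · have : 0 ≤ H n / 4 ^ n := by positivity
        linarith
    simp_rw [hdiam]
    rw [ENNReal.tsum_eq_iSup_sum]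
    refine iSup_le fun A => ?_
    rw [Finset.sum_const, nsmul_eq_mul, ← mul_assoc,
      ENNReal.ofReal_mul (by have := hH0 n; positivity)]
    gcongr
    rw [← ENNReal.ofReal_natCast]
    refine ENNReal.ofReal_le_ofReal ?_
    rcases A.eq_empty_or_nonempty with rfl | ⟨F₀, -⟩
    · have := hH0 n
      rw [Finset.card_empty, Nat.cast_zero]; positivity
    have hn : n₀ ≤ n := F₀.2.1
    rw [← Finset.card_map (Function.Embedding.subtype _)]
    refine card_near_cone_dyadic_le (hHn n) (hH4 n hn) (by positivity) ?_ ?_ ?_ ?_ <;>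
      intro F hF <;> obtain ⟨F', -, rfl⟩ := Finset.mem_map.1 hF
    exacts [F'.2.2.1, F'.2.2.2.1, F'.2.2.2.2.1, F'.2.2.2.2.2]
  refine measure_mono_null ?_ (hausdorffMeasure_limsup_eq_zero hs0 B hB)
  rintro t ⟨htT, hinf⟩
  refine Set.Infinite.of_image Sigma.fst
    ((hinf.sdiff (Set.finite_lt_nat n₀)).mono ?_)
  rintro n ⟨⟨d, w, v, h1, h2, h3, h4⟩, hn⟩
  have hn' : n₀ ≤ n := not_lt.1 hn
  obtain ⟨hδ1, -⟩ := hn₀ n hn'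
  have hδn := hδ0 n
  have hx0 : (1 : ℝ) ≤ 2 ^ n := one_le_pow₀ (by norm_num)
  have hd0 : (0 : ℝ) < d := by linarith
  rw [pow_succ] at h2
  have hdt : |d * t| ≤ T * d := by
    rw [abs_mul, abs_of_pos hd0, mul_comm]; gcongr
  have hw : |(w : ℝ)| ≤ (T + 1) * d := by
    have := abs_sub_abs_le_abs_sub (w : ℝ) (d * t)
    rw [abs_sub_comm] at this
    linarith
  have hdisc : |((d * v - w ^ 2 : ℤ) : ℝ)| ≤ H n := by
    have e : ((d * v - w ^ 2 : ℤ) : ℝ) =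
        (d * t - w) * (d * t + w) - d * (d * t ^ 2 - v) := by push_cast; ring
    rw [e]
    calc _ ≤ |(d * t - w) * (d * t + w)| + |d * (d * t ^ 2 - v)| := abs_sub _ _
      _ ≤ δ n * (T * d + (T + 1) * d) + d * δ n := by
        rw [abs_mul, abs_mul, abs_of_pos hd0]
        gcongr
        exact (abs_add_le _ _).trans (add_le_add hdt hw)
      _ = (2 * T + 2) * d * δ n := by ring
      _ ≤ (2 * T + 2) * (2 ^ n * 2) * δ n := by gcongr
      _ = C * (2 ^ n * δ n) := by rw [hCdef]; ring
      _ ≤ _ := le_add_of_nonneg_right (by positivity)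
  refine ⟨⟨n, ⟨(d, w, v), hn', hw, h1, by linarith, hdisc⟩⟩, ?_, rfl⟩
  have hclose : |t - w / d| ≤ H n / 4 ^ n := by
    have e : t - w / d = (d * t - w) / d := by field_simp
    rw [e, abs_div, abs_of_pos hd0]
    calc |d * t - w| / d ≤ δ n / 2 ^ n := by gcongr
      _ = 2 ^ n * δ n / 4 ^ n := by
        rw [show (4 : ℝ) ^ n = 2 ^ n * 2 ^ n by rw [← mul_pow]; norm_num]; field_simp
      _ ≤ H n / 4 ^ n := by
        gcongr
        have : 1 * (2 ^ n * δ n) ≤ C * (2 ^ n * δ n) := by gcongr; linarith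
        have : (0 : ℝ) ≤ (n + 1) ^ 2 := by positivity
        simp only [hHdef]; linarith
  rw [abs_le] at hclose
  simp only [Set.mem_ofPred_eq, hBdef, Set.mem_Icc]
  constructor <;> linarith

theorem IsApproxFun.summable_dyadic {ψ : ℝ → ℝ} (hψ : IsApproxFun ψ) {s : ℝ}
    (hs : s ∈ Set.Ioo (1 / 2 : ℝ) 1)
    (hconv : Summable (fun h : ℕ => (h : ℝ) ^ (1 - s) * ψ h ^ (s + 1))) :
    Summable fun n : ℕ => ((2 : ℝ) ^ n) ^ (2 - s) * ψ (2 ^ n) ^ (s + 1) := by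
  obtain ⟨hs1, hs2⟩ := hs
  set f : ℕ → ℝ := fun h => (h : ℝ) ^ (1 - s) * ψ h ^ (s + 1) with hf
  have hf0 : ∀ h : ℕ, 0 ≤ f h := by
    intro h
    rcases Nat.eq_zero_or_pos h with rfl | hh
    · simp [hf, Real.zero_rpow (by linarith : 1 - s ≠ 0)]
    · have := hψ.2 h (by exact_mod_cast hh)
      positivity
  have hblock : Summable fun n : ℕ => ∑ h ∈ Finset.Ioc (2 ^ n) (2 ^ (n + 1)), f h := by
    refine summable_of_sum_range_le (c := ∑' h, f h) (fun n => Finset.sum_nonneg fun h _ => hf0 h)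
      fun N => ?_
    have : ∑ n ∈ Finset.range N, ∑ h ∈ Finset.Ioc (2 ^ n) (2 ^ (n + 1)), f h =
        ∑ h ∈ Finset.Ioc 1 (2 ^ N), f h := by
      induction N with
      | zero => simp
      | succ N ih =>
        rw [Finset.sum_range_succ, ih, Finset.sum_Ioc_consecutive f Nat.one_le_two_pow
          (Nat.pow_le_pow_right two_pos N.le_succ)]
    rw [this]
    exact hconv.sum_le_tsum _ fun h _ => hf0 h
  rw [← summable_nat_add_iff 1]
  have hpos : ∀ n : ℕ, 0 < ψ (2 ^ n) := fun n => hψ.2 _ (by positivity)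
  refine Summable.of_nonneg_of_le (fun n => ?_) (fun n => ?_) (hblock.mul_left 4)
  · have := hpos (n + 1)
    positivity
  · set x : ℝ := 2 ^ n with hx
    have hx0 : 0 < x := by positivity
    have hP := hpos (n + 1)
    have hterm : ∀ h ∈ Finset.Ioc (2 ^ n) (2 ^ (n + 1)),
        x ^ (1 - s) * ψ (2 ^ (n + 1)) ^ (s + 1) ≤ f h := by
      intro h hh
      rw [Finset.mem_Ioc] at hh
      have h1 : x ≤ h := by rw [hx]; exact_mod_cast hh.1.le
      have h2 : (h : ℝ) ≤ 2 ^ (n + 1) := by exact_mod_cast hh.2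
      have h3 := hψ.1 h _ (hx0.trans_le h1) h2
      have h4 : 0 ≤ 1 - s := by linarith
      simp only [hf]
      gcongr
    have hsum := Finset.card_nsmul_le_sum _ _ _ hterm
    rw [Nat.card_Ioc, nsmul_eq_mul, pow_succ, mul_two, Nat.add_sub_cancel] at hsum
    push_cast at hsum
    rw [← hx] at hsum
    have h22 : (2 : ℝ) ^ (2 - s) ≤ 4 := by
      calc (2 : ℝ) ^ (2 - s) ≤ 2 ^ (2 : ℝ) :=
            Real.rpow_le_rpow_of_exponent_le (by norm_num) (by linarith)
        _ = 4 := by norm_num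
    calc ((2 : ℝ) ^ (n + 1)) ^ (2 - s) * ψ (2 ^ (n + 1)) ^ (s + 1)
        = 2 ^ (2 - s) * (x * (x ^ (1 - s) * ψ (2 ^ (n + 1)) ^ (s + 1))) := by
          rw [pow_succ (2 : ℝ), ← hx, Real.mul_rpow hx0.le (by norm_num),
            show 2 - s = 1 + (1 - s) by ring, Real.rpow_add hx0, Real.rpow_one]
          ring
      _ ≤ 4 * (x * (x ^ (1 - s) * ψ (2 ^ (n + 1)) ^ (s + 1))) := by gcongr
      _ ≤ _ := by gcongr; simpa only [pow_succ, mul_two] using hsum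

/-- The function `n ↦ 2ᶜ ψ(2ⁿ⁻ᶜ)`, dominating `C ψ(q)` for `q ≥ 2ⁿ / C` when `C ≤ 2ᶜ`. -/
def dyadicScale (ψ : ℝ → ℝ) (c n : ℕ) : ℝ := 2 ^ c * ψ (2 ^ (n - c))

theorem IsApproxFun.dyadicScale_pos {ψ : ℝ → ℝ} (hψ : IsApproxFun ψ) (c n : ℕ) :
    0 < dyadicScale ψ c n := mul_pos (by positivity) (hψ.2 _ (by positivity))

theorem IsApproxFun.summable_dyadicScale {ψ : ℝ → ℝ} (hψ : IsApproxFun ψ) {s : ℝ}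
    (hs : s ∈ Set.Ioo (1 / 2 : ℝ) 1)
    (hconv : Summable (fun h : ℕ => (h : ℝ) ^ (1 - s) * ψ h ^ (s + 1))) (c : ℕ) :
    Summable fun n : ℕ => ((2 : ℝ) ^ n) ^ (2 - s) * dyadicScale ψ c n ^ (s + 1) := by
  rw [← summable_nat_add_iff c]
  refine ((hψ.summable_dyadic hs hconv).mul_left (((2 : ℝ) ^ c) ^ (2 - s) * (2 ^ c) ^ (s + 1))).congr
    fun n => ?_
  have := hψ.2 (2 ^ n) (by positivity)
  rw [dyadicScale, Nat.add_sub_cancel, pow_add, Real.mul_rpow (by positivity) (by positivity),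
    Real.mul_rpow (by positivity) this.le]
  ring

theorem mem_parabolaApprox_of_int_forms {ψ : ℝ → ℝ} (hψ : IsApproxFun ψ) {y : ℝ × ℝ}
    (hy : y ∈ SimApprox2 ψ) (m : Fin 3 → Fin 3 → ℤ) {l t : ℝ} (hl : 0 < l)
    (h0 : m 0 0 + m 0 1 * y.1 + m 0 2 * y.2 = l)
    (h1 : m 1 0 + m 1 1 * y.1 + m 1 2 * y.2 = l * t)
    (h2 : m 2 0 + m 2 1 * y.1 + m 2 2 * y.2 = l * t ^ 2) :
    ∃ c : ℕ, t ∈ parabolaApprox (dyadicScale ψ c) (2 ^ c) := by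
  obtain ⟨A, hA0, hA⟩ : ∃ A : ℝ, 0 ≤ A ∧ ∀ i, |(m i 1 : ℝ)| + |(m i 2 : ℝ)| ≤ A := by
    refine ⟨∑ i, (|(m i 1 : ℝ)| + |(m i 2 : ℝ)|), by positivity, fun i => ?_⟩
    exact Finset.single_le_sum (f := fun i => |(m i 1 : ℝ)| + |(m i 2 : ℝ)|)
      (fun i _ => by positivity) (Finset.mem_univ i)
  obtain ⟨c, hc⟩ := pow_unbounded_of_one_lt (A * (1 + |t| + t ^ 2) + 2 * l + |t|)
    (one_lt_two : (1 : ℝ) < 2)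
  have ht2 : 0 ≤ t ^ 2 := sq_nonneg t
  have ht1 : 0 ≤ |t| := abs_nonneg t
  have hAt1 : 0 ≤ A * |t| := by positivity
  have hAt2 : 0 ≤ A * t ^ 2 := by positivity
  refine ⟨c, by linarith, Set.infinite_of_forall_exists_gt fun n₀ => ?_⟩
  obtain ⟨q₀, hq₀⟩ := exists_nat_gt ((2 * A * ψ 1 + 2 * 2 ^ (n₀ + 1)) / l)
  obtain ⟨q, ⟨hq0, hq⟩, hqq⟩ := hy.exists_gt q₀
  have hqq' : 2 * A * ψ 1 + 2 * 2 ^ (n₀ + 1) < q * l := by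
    have : (q₀ : ℝ) < q := by exact_mod_cast hqq
    rw [div_lt_iff₀ hl] at hq₀
    nlinarith
  have hq1 : (1 : ℝ) ≤ q := by exact_mod_cast hq0
  have hψq : ψ q ≤ ψ 1 := hψ.1 1 q one_pos hq1
  have hψq0 : 0 < ψ q := hψ.2 q (by linarith)
  rw [max_lt_iff, distNearestInt, distNearestInt] at hq
  set p₁ := round ((q : ℝ) * y.1)
  set p₂ := round ((q : ℝ) * y.2)
  set F : Fin 3 → ℤ := fun i => m i 0 * q + m i 1 * p₁ + m i 2 * p₂ with hF
  set r : Fin 3 → ℝ := fun i => q * (m i 0 + m i 1 * y.1 + m i 2 * y.2) - F i with hr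
  have hrle : ∀ i, |r i| ≤ A * ψ q := by
    intro i
    have e : r i = m i 1 * (q * y.1 - p₁) + m i 2 * (q * y.2 - p₂) := by
      simp only [hr, hF]; push_cast; ring
    rw [e]
    refine (abs_add_le _ _).trans ?_
    rw [abs_mul, abs_mul]
    calc _ ≤ |(m i 1 : ℝ)| * ψ q + |(m i 2 : ℝ)| * ψ q := by
          gcongr
          exacts [hq.1.le, hq.2.le]
      _ = (|(m i 1 : ℝ)| + |(m i 2 : ℝ)|) * ψ q := by ring
      _ ≤ _ := by gcongr; exact hA i
  have e0 : (F 0 : ℝ) = q * l - r 0 := by simp only [hr]; rw [h0]; ring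
  have e1 : (F 1 : ℝ) = q * (l * t) - r 1 := by simp only [hr]; rw [h1]; ring
  have e2 : (F 2 : ℝ) = q * (l * t ^ 2) - r 2 := by simp only [hr]; rw [h2]; ring
  have hAψ : A * ψ q ≤ A * ψ 1 := by gcongr
  have hr0 := abs_le.1 ((hrle 0).trans hAψ)
  have hpow : (0 : ℝ) < 2 ^ (n₀ + 1) := by positivity
  have hF0l : (2 : ℝ) ^ (n₀ + 1) < F 0 := by
    rw [e0]
    have : 0 ≤ A * ψ q := by positivity
    linarith
  have hF0u : (F 0 : ℝ) ≤ q * (2 * l) := by rw [e0]; linarith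
  have hF0pos : 0 < F 0 := by
    have : (0 : ℝ) < F 0 := hpow.trans hF0l
    exact_mod_cast this
  obtain ⟨D, hD⟩ := Int.eq_ofNat_of_zero_le hF0pos.le
  have hDF : (F 0 : ℝ) = D := by rw [hD]; simp
  have hD0 : D ≠ 0 := by rintro rfl; simp [hD] at hF0pos
  set n := Nat.log 2 D
  have hnl : (2 : ℝ) ^ n ≤ F 0 := by rw [hDF]; exact_mod_cast Nat.pow_log_le_self 2 hD0
  have hnu : (F 0 : ℝ) < 2 ^ (n + 1) := by
    rw [hDF]; exact_mod_cast Nat.lt_pow_succ_log_self one_lt_two D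
  have hnn : n₀ < n := by
    have : (2 : ℝ) ^ (n₀ + 1) < 2 ^ (n + 1) := hF0l.trans hnu
    have := (pow_lt_pow_iff_right₀ (one_lt_two : (1 : ℝ) < 2)).1 this
    omega
  have hscale : ψ q ≤ ψ (2 ^ (n - c)) := by
    refine hψ.1 _ _ (by positivity) ?_
    rcases le_total c n with hcn | hcn
    · have h3 : (2 : ℝ) ^ (n - c) * 2 ^ c ≤ q * 2 ^ c := by
        rw [← pow_add, Nat.sub_add_cancel hcn]
        refine (hnl.trans hF0u).trans ?_
        gcongr
        have : 0 ≤ A * (1 + |t| + t ^ 2) := by positivity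
        linarith
      exact le_of_mul_le_mul_right h3 (by positivity)
    · rw [Nat.sub_eq_zero_of_le hcn, pow_zero]; exact hq1
  have hbig : ∀ u : ℝ, |u| ≤ |t| + t ^ 2 → ∀ i, |u * r 0 - r i| ≤ dyadicScale ψ c n := by
    intro u hu i
    calc |u * r 0 - r i| ≤ |u| * |r 0| + |r i| := by rw [← abs_mul]; exact abs_sub _ _
      _ ≤ (|t| + t ^ 2) * (A * ψ q) + A * ψ q := by gcongr; exacts [hrle 0, hrle i]
      _ = A * (1 + |t| + t ^ 2) * ψ q := by ring
      _ ≤ 2 ^ c * ψ (2 ^ (n - c)) := by gcongr; linarith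
  refine ⟨n, ⟨F 0, F 1, F 2, hnl, hnu, ?_, ?_⟩, hnn⟩
  · have := hbig t (by linarith) 1
    rw [← abs_neg] at this
    convert this using 2
    rw [e0, e1]; ring
  · have := hbig (t ^ 2) (by rw [abs_of_nonneg ht2]; linarith) 2
    rw [← abs_neg] at this
    convert this using 2
    rw [e0, e2]; ring

theorem mem_parabolaApprox_of_rat_forms {ψ : ℝ → ℝ} (hψ : IsApproxFun ψ) {y : ℝ × ℝ}
    (hy : y ∈ SimApprox2 ψ) (m : Fin 3 → Fin 3 → ℚ) {l t : ℝ} (hl : l ≠ 0)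
    (h0 : m 0 0 + m 0 1 * y.1 + m 0 2 * y.2 = l)
    (h1 : m 1 0 + m 1 1 * y.1 + m 1 2 * y.2 = l * t)
    (h2 : m 2 0 + m 2 1 * y.1 + m 2 2 * y.2 = l * t ^ 2) :
    ∃ c : ℕ, t ∈ parabolaApprox (dyadicScale ψ c) (2 ^ c) := by
  set D : ℤ := ∏ i, ∏ j, ((m i j).den : ℤ) with hD
  have hD0 : D ≠ 0 := Finset.prod_ne_zero_iff.2 fun i _ => Finset.prod_ne_zero_iff.2 fun j _ => by
    exact_mod_cast (m i j).den_nz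
  have hex : ∀ i j, ∃ z : ℤ, (z : ℝ) = D * m i j := by
    intro i j
    obtain ⟨z, hz⟩ : ((m i j).den : ℤ) ∣ D :=
      (Finset.dvd_prod_of_mem (fun j => ((m i j).den : ℤ)) (Finset.mem_univ j)).trans
        (Finset.dvd_prod_of_mem (fun i => ∏ j, ((m i j).den : ℤ)) (Finset.mem_univ i))
    refine ⟨z * (m i j).num, ?_⟩
    have hden : ((m i j).den : ℝ) ≠ 0 := by exact_mod_cast (m i j).den_nz
    rw [hz]
    conv_rhs => rw [Rat.cast_def]
    push_cast
    field_simp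
  choose M hM using hex
  obtain ⟨ε, hε⟩ : ∃ ε : ℤ, 0 < (ε : ℝ) * (D * l) := by
    have hDl : (D : ℝ) * l ≠ 0 := mul_ne_zero (by exact_mod_cast hD0) hl
    rcases lt_or_gt_of_ne hDl with h | h
    exacts [⟨-1, by simpa using h⟩, ⟨1, by simpa using h⟩]
  refine mem_parabolaApprox_of_int_forms hψ hy (fun i j => ε * M i j) (l := ε * (D * l)) hε ?_ ?_ ?_
  · push_cast; rw [hM, hM, hM, ← h0]; ring
  · push_cast; rw [hM, hM, hM]; linear_combination (ε * D : ℝ) * h1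
  · push_cast; rw [hM, hM, hM]; linear_combination (ε * D : ℝ) * h2

theorem hausdorffMeasure_image_eq_zero_of_contDiffAt {X Y : Type*} [NormedAddCommGroup X]
    [NormedSpace ℝ X] [SecondCountableTopology X] [MeasurableSpace X] [BorelSpace X]
    [NormedAddCommGroup Y] [NormedSpace ℝ Y] [MeasurableSpace Y] [BorelSpace Y] {s : ℝ}
    (hs : 0 ≤ s) {f : X → Y} {A : Set X} (hf : ∀ x ∈ A, ContDiffAt ℝ 1 f x)
    (hA : μH[s] A = 0) : μH[s] (f '' A) = 0 := by
  have : OuterMeasure.comap f (μH[s] : Measure Y).toOuterMeasure A = 0 := by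
    refine measure_null_of_locally_null _ fun x hx => ?_
    obtain ⟨K, u, hu, hK⟩ := (hf x hx).exists_lipschitzOnWith
    refine ⟨A ∩ u, inter_mem self_mem_nhdsWithin (mem_nhdsWithin_of_mem_nhds hu), ?_⟩
    rw [OuterMeasure.comap_apply]
    refine le_antisymm ?_ zero_le
    refine ((hK.mono Set.inter_subset_right).hausdorffMeasure_image_le hs).trans ?_
    rw [measure_mono_null Set.inter_subset_left hA, mul_zero]
  rwa [OuterMeasure.comap_apply] at this

/-- If, outside a countable set, `S` is parametrized by `φ`, with `(1, t, t²)` proportional to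
three rational affine forms in `φ t`, then affine rational images of `S` satisfy the
convergence statement. -/
theorem hausdorffMeasure_affine_image_inter_simApprox2 {s : ℝ} (hs : s ∈ Set.Ioo (1 / 2 : ℝ) 1)
    {ψ : ℝ → ℝ} (hψ : IsApproxFun ψ)
    (hconv : Summable (fun h : ℕ => (h : ℝ) ^ (1 - s) * ψ h ^ (s + 1)))
    {a b c d e g : ℚ} (hdet : a * d - b * c ≠ 0) {S E : Set (ℝ × ℝ)} (hE : E.Countable)
    (k : Fin 3 → Fin 3 → ℚ) (φ : ℝ → ℝ × ℝ) {U : Set ℝ} (hφ : ∀ t ∈ U, ContDiffAt ℝ 1 φ t)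
    (hS : ∀ x ∈ S, x ∈ E ∨ ∃ t ∈ U, φ t = x ∧ ∃ l : ℝ, l ≠ 0 ∧
      k 0 0 + k 0 1 * x.1 + k 0 2 * x.2 = l ∧ k 1 0 + k 1 1 * x.1 + k 1 2 * x.2 = l * t ∧
      k 2 0 + k 2 1 * x.1 + k 2 2 * x.2 = l * t ^ 2) :
    μH[s] ((fun p : ℝ × ℝ => ((a : ℝ) * p.1 + (b : ℝ) * p.2 + (e : ℝ),
      (c : ℝ) * p.1 + (d : ℝ) * p.2 + (g : ℝ))) '' S ∩ SimApprox2 ψ) = 0 := by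
  have hs0 : 0 < s := by linarith [hs.1]
  set α : ℝ × ℝ → ℝ × ℝ := fun p => ((a : ℝ) * p.1 + (b : ℝ) * p.2 + (e : ℝ),
      (c : ℝ) * p.1 + (d : ℝ) * p.2 + (g : ℝ)) with hα
  have hαφ : ∀ t ∈ U, ContDiffAt ℝ 1 (α ∘ φ) t := fun t ht =>
    ContDiffAt.comp t (by simp only [hα]; fun_prop) (hφ t ht)
  have hdet' : (a : ℝ) * d - b * c ≠ 0 := by exact_mod_cast hdet
  set m : Fin 3 → Fin 3 → ℚ := fun i => ![k i 0 - (k i 1 * d - k i 2 * c) / (a * d - b * c) * e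
      - (k i 2 * a - k i 1 * b) / (a * d - b * c) * g,
    (k i 1 * d - k i 2 * c) / (a * d - b * c), (k i 2 * a - k i 1 * b) / (a * d - b * c)] with hm
  have hmk : ∀ i (x : ℝ × ℝ), (m i 0 : ℝ) + m i 1 * (α x).1 + m i 2 * (α x).2 =
      k i 0 + k i 1 * x.1 + k i 2 * x.2 := by
    intro i x
    simp only [hm, hα, Matrix.cons_val_zero, Matrix.cons_val_one, Matrix.cons_val]
    push_cast
    have hi : ((a : ℝ) * d - b * c) * ((a : ℝ) * d - b * c)⁻¹ = 1 := mul_inv_cancel₀ hdet'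
    linear_combination ((k i 1 : ℝ) * x.1 + k i 2 * x.2) * hi
  have hnull : ∀ n, μH[s] (α ∘ φ '' (parabolaApprox (dyadicScale ψ n) (2 ^ n) ∩ U)) = 0 := fun n =>
    hausdorffMeasure_image_eq_zero_of_contDiffAt hs0.le (fun t ht => hαφ t ht.2)
      (measure_mono_null Set.inter_subset_left (hausdorffMeasure_parabolaApprox hs
        (fun n => (hψ.dyadicScale_pos _ n).le) (hψ.summable_dyadicScale hs hconv n) (by positivity)))
  have hEnull : μH[s] (α '' E) = 0 := by
    have := Measure.nullSingletonClass_hausdorff (ℝ × ℝ) hs0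
    exact (hE.image α).measure_zero _
  refine measure_mono_null ?_ (measure_union_null hEnull (measure_iUnion_null hnull))
  rintro _ ⟨⟨x, hx, rfl⟩, hy⟩
  rcases hS x hx with hxE | ⟨t, htU, rfl, l, hl, h0, h1, h2⟩
  · exact Or.inl ⟨x, hxE, rfl⟩
  · rw [← hmk] at h0 h1 h2
    obtain ⟨n, hn⟩ := mem_parabolaApprox_of_rat_forms hψ hy m hl h0 h1 h2
    exact Or.inr (Set.mem_iUnion.2 ⟨n, t, ⟨hn, htU⟩, rfl⟩)

theorem rational_quadric_hausdorff_convergence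
    (s : ℝ) (hs : s ∈ Set.Ioo (1/2 : ℝ) 1)
    (ψ : ℝ → ℝ) (hψ : IsApproxFun ψ)
    (Q : Set (ℝ × ℝ)) (hQ : IsRatQuadric Q)
    (hconv : Summable (fun h : ℕ => (h : ℝ) ^ (1 - s) * ψ h ^ (s + 1))) :
    μH[s] (Q ∩ SimApprox2 ψ) = 0 := by
  obtain ⟨a, b, c, d, e, g, hdet, S, hS, rfl⟩ := hQ
  rcases hS with rfl | rfl | rfl
  · refine hausdorffMeasure_affine_image_inter_simApprox2 hs hψ hconv hdet (E := {(1, 0)})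
      (Set.countable_singleton _) ![![1, -1, 0], ![0, 0, 1], ![1, 1, 0]]
      (fun t => ((t ^ 2 - 1) / (t ^ 2 + 1), 2 * t / (t ^ 2 + 1))) (U := Set.univ) ?_ ?_
    · intro t _
      have : t ^ 2 + 1 ≠ 0 := by positivity
      fun_prop (disch := assumption)
    · rintro ⟨x, y⟩ hxy
      simp only [Set.mem_ofPred_eq] at hxy
      by_cases hx : 1 - x = 0
      · left
        have hx1 : x = 1 := by linarith
        subst hx1
        have : y = 0 := by nlinarith
        simp [this]
      · right
        have hsum : (y / (1 - x)) ^ 2 + 1 = 2 / (1 - x) := by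
          field_simp
          linear_combination hxy
        refine ⟨y / (1 - x), trivial, ?_, 1 - x, hx, ?_, ?_, ?_⟩
        · simp only [hsum, Prod.mk.injEq]
          constructor
          · rw [show (y / (1 - x)) ^ 2 - 1 = ((y / (1 - x)) ^ 2 + 1) - 2 by ring, hsum]
            field_simp
            ring
          · field_simp
        · simp; ring
        · simp; field_simp
        · simp
          field_simp
          linear_combination -hxy
  · refine hausdorffMeasure_affine_image_inter_simApprox2 hs hψ hconv hdet (E := ∅)
      Set.countable_empty ![![1, 0, 0], ![0, 1, 0], ![0, 0, 1]]
      (fun t => (t, t ^ 2)) (U := Set.univ) (fun t _ => by fun_prop) ?_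
    rintro ⟨x, y⟩ hxy
    simp only [Set.mem_ofPred_eq] at hxy
    subst hxy
    exact Or.inr ⟨x, trivial, rfl, 1, one_ne_zero, by simp, by simp, by simp⟩
  · refine hausdorffMeasure_affine_image_inter_simApprox2 hs hψ hconv hdet (E := ∅)
      Set.countable_empty ![![0, 1, 1], ![1, 0, 0], ![0, 1, -1]]
      (fun t => ((t⁻¹ + t) / 2, (t⁻¹ - t) / 2)) (U := {0}ᶜ) ?_ ?_
    · intro t ht
      have : t ≠ 0 := ht
      fun_prop (disch := assumption)
    · rintro ⟨x, y⟩ hxy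
      simp only [Set.mem_ofPred_eq] at hxy
      have hmul : (x - y) * (x + y) = 1 := by linear_combination hxy
      have h1 : x - y ≠ 0 := left_ne_zero_of_mul_eq_one hmul
      have h2 : x + y ≠ 0 := right_ne_zero_of_mul_eq_one hmul
      have hinv : (x - y)⁻¹ = x + y := inv_eq_of_mul_eq_one_right hmul
      refine Or.inr ⟨x - y, h1, ?_, x + y, h2, ?_, ?_, ?_⟩
      · simp only [hinv, Prod.mk.injEq]
        constructor <;> ring
      · simp
      · simp; linear_combination -hmul
      · simp; linear_combination -(x - y) * hmul
end

section
/- Let I₀ be a finite open interval of ℝ and f ∈ C³(I₀) with 0 < c₁ := inf_{x∈I₀} |f''(x)| ≤ c₂ := sup_{x∈I₀} |f''(x)| < ∞. Let ψ be an approximating function with lim_{t→∞} ψ(t) = 0 and lim_{t→∞} t ψ(t) = ∞. Then for any interval I ⊆ I₀ there exists a constant c > 0 (depending on I) such that for all sufficiently large Q one has N_f(Q, ψ, I) ≥ c Q² ψ(Q) |I|. -/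
open MeasureTheory Filter

/-- The least `q ∈ ℕ` with `q • r ∈ ℤ²`, for a rational point `r ∈ ℚ²`:
the lcm of the denominators. -/
def den2 (r : ℚ × ℚ) : ℕ := Nat.lcm r.1.den r.2.den

/-- The counting function `N_f(Q, ψ, I)`: the number of rational points `p/q ∈ ℚ²`
with `q ≤ Q`, `p₁/q ∈ I` and `|f(p₁/q) − p₂/q| < ψ(Q)/Q`. -/
noncomputable def Nf (f : ℝ → ℝ) (ψ : ℝ → ℝ) (Q : ℝ) (I : Set ℝ) : ℕ :=
  Nat.card {r : ℚ × ℚ | (den2 r : ℝ) ≤ Q ∧ ((r.1 : ℝ) ∈ I) ∧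
    |f (r.1 : ℝ) - (r.2 : ℝ)| < ψ Q / Q}

theorem exists_slope_eq {s : Set ℝ} (hs : s.OrdConnected) {h h' : ℝ → ℝ}
    (hd : ∀ x ∈ s, HasDerivAt h (h' x) x) {y z : ℝ} (hy : y ∈ s) (hz : z ∈ s) :
    ∃ ξ ∈ Set.uIcc y z, h y - h z = h' ξ * (y - z) := by
  wlog hyz : y ≤ z generalizing y z
  · obtain ⟨ξ, h1, h2⟩ := this hz hy (le_of_not_ge hyz)
    exact ⟨ξ, Set.uIcc_comm z y ▸ h1, by linarith⟩
  rcases hyz.eq_or_lt with rfl | hlt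
  · exact ⟨y, by simp, by simp⟩
  have hsub : Set.Icc y z ⊆ s := hs.out hy hz
  obtain ⟨ξ, h1, h2⟩ := exists_hasDerivAt_eq_slope h h' hlt
    (fun x hx => (hd x (hsub hx)).continuousAt.continuousWithinAt)
    (fun x hx => hd x (hsub (Set.Ioo_subset_Icc_self hx)))
  refine ⟨ξ, by rw [Set.uIcc_of_le hyz]; exact Set.Ioo_subset_Icc_self h1, ?_⟩
  have : z - y ≠ 0 := by linarith
  rw [h2]; field_simp; ring

theorem volume_le_of_abs_sub_le {S : Set ℝ} {d : ℝ}
    (h : ∀ y ∈ S, ∀ z ∈ S, |y - z| ≤ d) : volume S ≤ ENNReal.ofReal d := by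
  refine (Real.volume_le_diam S).trans (Metric.ediam_le fun y hy z hz => ?_)
  rw [edist_dist, Real.dist_eq]
  exact ENNReal.ofReal_le_ofReal (h y hy z hz)

/-- Points of small value are close together where the derivative is large. -/
theorem abs_sub_le_of_deriv_large {s : Set ℝ} (hs : s.OrdConnected) {h h' : ℝ → ℝ}
    (hd : ∀ x ∈ s, HasDerivAt h (h' x) x) {l e : ℝ} (hl : 0 < l)
    {y z : ℝ} (hy : y ∈ s) (hz : z ∈ s)
    (hbig : ∀ ξ ∈ Set.uIcc y z, l ≤ |h' ξ|)
    (hye : |h y| < e) (hze : |h z| < e) : |y - z| ≤ 2 * e / l := by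
  obtain ⟨ξ, h1, h2⟩ := exists_slope_eq hs hd hy hz
  have h3 : |h y - h z| ≤ 2 * e := (abs_sub _ _).trans (by linarith)
  rw [h2, abs_mul] at h3
  rw [le_div_iff₀ hl]
  nlinarith [hbig ξ h1, abs_nonneg (y - z)]

theorem volume_sublevel_le {c C x r M w₁ w₂ ε : ℝ} {Y Z g : ℝ → ℝ}
    (hc : 0 < c) (hcC : c ≤ C) (hr : 0 < r) (hM : 0 ≤ M) (hw₁ : 0 < w₁) (hw₂ : 0 < w₂)
    (hε : 0 < ε) (hε' : ε ≤ 1 / 8)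
    (hYlow : ∀ y ∈ Metric.closedBall x (2 * r), ∀ z ∈ Metric.closedBall x (2 * r),
      c * M * |y - z| ≤ |Y y - Y z|)
    (hYup : ∀ y ∈ Metric.closedBall x (2 * r), ∀ z ∈ Metric.closedBall x (2 * r),
      |Y y - Y z| ≤ C * M * |y - z|)
    (hmono : MonotoneOn Y (Metric.closedBall x (2 * r)) ∨
      AntitoneOn Y (Metric.closedBall x (2 * r)))
    (hZ : ∀ y ∈ Metric.closedBall x (2 * r), HasDerivAt Z (g y * Y y) y)
    (hg : ∀ y ∈ Metric.closedBall x (2 * r), c ≤ |g y| ∧ |g y| ≤ C)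
    (hlarge : ∃ y ∈ Metric.closedBall x (2 * r), 1 / 4 * w₁ ≤ |Y y| ∨ 1 / 4 * w₂ ≤ |Z y|) :
    volume {y ∈ Metric.closedBall x r | |Y y| < ε * w₁ ∧ |Z y| < ε * w₂} ≤
      ENNReal.ofReal (128 * (C / c) * √ε * r) := by
  have hC : 0 < C := hc.trans_le hcC
  set K := Metric.closedBall x (2 * r) with hK
  have hKo : K.OrdConnected := by rw [hK, Real.closedBall_eq_Icc]; exact Set.ordConnected_Icc
  have hsub : Metric.closedBall x r ⊆ K := Metric.closedBall_subset_closedBall (by linarith)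
  have hKd : ∀ y ∈ K, ∀ z ∈ K, |y - z| ≤ 4 * r := by
    intro y hy z hz
    rw [hK, Real.closedBall_eq_Icc, Set.mem_Icc] at hy hz
    rw [abs_le]; constructor <;> linarith [hy.1, hy.2, hz.1, hz.2]
  set A := {y ∈ Metric.closedBall x r | |Y y| < ε * w₁ ∧ |Z y| < ε * w₂} with hA
  have hs0 : 0 < √ε := Real.sqrt_pos.2 hε
  have hss : √ε * √ε = ε := Real.mul_self_sqrt hε.le
  have hεs : ε ≤ √ε := by nlinarith
  rcases A.eq_empty_or_nonempty with hAe | ⟨y₁, hy₁⟩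
  · rw [hAe]; simp
  have hy₁K : y₁ ∈ K := hsub hy₁.1
  obtain ⟨y₀, hy₀, hY | hZ0⟩ := hlarge
  · have h1 : |Y y₀| - |Y y₁| ≤ |Y y₀ - Y y₁| := abs_sub_abs_le_abs_sub _ _
    have h2 := hYup y₀ hy₀ y₁ hy₁K
    have h3 := hKd y₀ hy₀ y₁ hy₁K
    have h4 : w₁ / 8 ≤ C * M * (4 * r) := by
      have : C * M * |y₀ - y₁| ≤ C * M * (4 * r) := by gcongr
      nlinarith [hy₁.2.1]
    have hMp : 0 < M := by
      rcases hM.eq_or_lt with h | h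
      · rw [← h] at h4; simp at h4; linarith
      · exact h
    refine volume_le_of_abs_sub_le fun y hy z hz => ?_
    have h5 := hYlow y (hsub hy.1) z (hsub hz.1)
    have h6 : |Y y - Y z| ≤ 2 * (ε * w₁) := (abs_sub _ _).trans (by linarith [hy.2.1, hz.2.1])
    have h7 : |y - z| ≤ 2 * (ε * w₁) / (c * M) := by
      rw [le_div_iff₀ (by positivity)]; linarith
    have h8 : 2 * (ε * w₁) / (c * M) ≤ 2 * (ε * (32 * C * M * r)) / (c * M) := by
      gcongr; linarith
    have h9 : 2 * (ε * (32 * C * M * r)) / (c * M) = 64 * (C / c) * ε * r := by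
      field_simp; ring
    have h10 : 64 * (C / c) * ε * r ≤ 128 * (C / c) * √ε * r := by gcongr; norm_num
    linarith
  · obtain ⟨ξ, hξ, hsl⟩ := exists_slope_eq hKo hZ hy₀ hy₁K
    have hξK : ξ ∈ K := hKo.uIcc_subset hy₀ hy₁K hξ
    have h1 : |Z y₀| - |Z y₁| ≤ |Z y₀ - Z y₁| := abs_sub_abs_le_abs_sub _ _
    have h3 := hKd y₀ hy₀ y₁ hy₁K
    set m := |Y ξ| with hm
    have hm0 : 0 ≤ m := abs_nonneg _
    have h4 : w₂ / 8 ≤ C * m * (4 * r) := by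
      have : |Z y₀ - Z y₁| ≤ C * m * (4 * r) := by
        rw [hsl, abs_mul, abs_mul]
        have := (hg ξ hξK).2
        gcongr
      nlinarith [hy₁.2.2]
    have hmp : 0 < m := by
      rcases hm0.eq_or_lt with h | h
      · rw [← h] at h4; simp at h4; linarith
      · exact h
    by_cases hbig : ∀ z ∈ K, m / 2 ≤ |Y z|
    · refine volume_le_of_abs_sub_le fun y hy z hz => ?_
      have h7 : |y - z| ≤ 2 * (ε * w₂) / (c * (m / 2)) := by
        refine abs_sub_le_of_deriv_large hKo hZ (by positivity) (hsub hy.1) (hsub hz.1) ?_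
          hy.2.2 hz.2.2
        intro t ht
        have htK : t ∈ K := hKo.uIcc_subset (hsub hy.1) (hsub hz.1) ht
        rw [abs_mul]
        exact mul_le_mul (hg t htK).1 (hbig t htK) (by positivity) (abs_nonneg _)
      have h8 : 2 * (ε * w₂) / (c * (m / 2)) ≤ 2 * (ε * (32 * C * m * r)) / (c * (m / 2)) := by
        gcongr; linarith
      have h9 : 2 * (ε * (32 * C * m * r)) / (c * (m / 2)) = 128 * (C / c) * ε * r := by
        field_simp; ring
      have h10 : 128 * (C / c) * ε * r ≤ 128 * (C / c) * √ε * r := by gcongr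
      linarith
    · push Not at hbig
      obtain ⟨z₀, hz₀, hz₀m⟩ := hbig
      have h5 : m ≤ 8 * C * M * r := by
        have e1 := hYup ξ hξK z₀ hz₀
        have e2 : |Y ξ| - |Y z₀| ≤ |Y ξ - Y z₀| := abs_sub_abs_le_abs_sub _ _
        have e3 : C * M * |ξ - z₀| ≤ C * M * (4 * r) := by
          gcongr; exact hKd ξ hξK z₀ hz₀
        linarith
      have hMp : 0 < M := by
        rcases hM.eq_or_lt with h | h
        · rw [← h] at h5; simp at h5; linarith
        · exact h
      have h6 : w₂ ≤ 256 * C ^ 2 * M * r ^ 2 := by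
        have : C * m * (4 * r) ≤ C * (8 * C * M * r) * (4 * r) := by gcongr
        nlinarith
      set l := 16 * C * √ε * r with hl
      have hlp : 0 < l := by positivity
      have hlM : ε * w₂ ≤ M * l ^ 2 := by
        have : M * l ^ 2 = ε * (256 * C ^ 2 * M * r ^ 2) := by
          rw [hl]; nlinarith [hss]
        rw [this]; gcongr
      have hcover : A ⊆ {y ∈ A | |Y y| < M * l} ∪ {y ∈ A | M * l ≤ Y y} ∪
          {y ∈ A | Y y ≤ -(M * l)} := by
        intro y hy
        simp only [Set.mem_union, Set.mem_ofPred_eq, hy, true_and, abs_lt]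
        by_cases h1 : M * l ≤ Y y
        · exact Or.inl (Or.inr h1)
        · by_cases h2 : Y y ≤ -(M * l)
          · exact Or.inr h2
          · exact Or.inl (Or.inl ⟨by linarith, by linarith⟩)
      have hmid : volume {y ∈ A | |Y y| < M * l} ≤ ENNReal.ofReal (2 * l / c) := by
        refine volume_le_of_abs_sub_le fun y hy z hz => ?_
        have e1 := hYlow y (hsub hy.1.1) z (hsub hz.1.1)
        have e2 : |Y y - Y z| ≤ 2 * (M * l) := (abs_sub _ _).trans (by linarith [hy.2, hz.2])
        rw [le_div_iff₀ hc]
        have : M * (c * |y - z|) ≤ M * (2 * l) := by linarith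
        linarith [le_of_mul_le_mul_left this hMp]
      have hside : ∀ S ⊆ A, (∀ y ∈ S, ∀ z ∈ S, ∀ t ∈ Set.uIcc y z, M * l ≤ |Y t|) →
          volume S ≤ ENNReal.ofReal (2 * l / c) := by
        intro S hS hSl
        refine volume_le_of_abs_sub_le fun y hy z hz => ?_
        have hyK := hsub (hS hy).1
        have hzK := hsub (hS hz).1
        have h7 : |y - z| ≤ 2 * (ε * w₂) / (c * (M * l)) := by
          refine abs_sub_le_of_deriv_large hKo hZ (by positivity) hyK hzK ?_
            (hS hy).2.2 (hS hz).2.2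
          intro t ht
          rw [abs_mul]
          exact mul_le_mul (hg t (hKo.uIcc_subset hyK hzK ht)).1 (hSl y hy z hz t ht)
            (by positivity) (abs_nonneg _)
        have h8 : 2 * (ε * w₂) / (c * (M * l)) ≤ 2 * (M * l ^ 2) / (c * (M * l)) := by gcongr
        have h9 : 2 * (M * l ^ 2) / (c * (M * l)) = 2 * l / c := by field_simp
        linarith
      have hbetw : ∀ y ∈ K, ∀ z ∈ K, ∀ t ∈ Set.uIcc y z, Y t ∈ Set.uIcc (Y y) (Y z) := by
        intro y hy z hz t ht
        have hs : Set.uIcc y z ⊆ K := hKo.uIcc_subset hy hz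
        rcases hmono with h | h
        · exact (h.mono hs).mapsTo_uIcc ht
        · exact (h.mono hs).mapsTo_uIcc ht
      have hup : volume {y ∈ A | M * l ≤ Y y} ≤ ENNReal.ofReal (2 * l / c) := by
        refine hside _ (fun y hy => hy.1) fun y hy z hz t ht => ?_
        have := (hbetw y (hsub hy.1.1) z (hsub hz.1.1) t ht).1
        exact ((le_inf hy.2 hz.2).trans this).trans (le_abs_self _)
      have hdown : volume {y ∈ A | Y y ≤ -(M * l)} ≤ ENNReal.ofReal (2 * l / c) := by
        refine hside _ (fun y hy => hy.1) fun y hy z hz t ht => ?_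
        have := (hbetw y (hsub hy.1.1) z (hsub hz.1.1) t ht).2
        have h' := this.trans (sup_le hy.2 hz.2)
        exact (by linarith : M * l ≤ -Y t).trans (neg_le_abs _)
      calc volume A ≤ _ := measure_mono hcover
        _ ≤ _ := (measure_union_le _ _).trans (add_le_add (measure_union_le _ _) le_rfl)
        _ ≤ _ := add_le_add (add_le_add hmid hup) hdown
        _ = ENNReal.ofReal (2 * l / c + 2 * l / c + 2 * l / c) := by
          rw [ENNReal.ofReal_add (by positivity) (by positivity),
            ENNReal.ofReal_add (by positivity) (by positivity)]
        _ ≤ _ := by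
          apply ENNReal.ofReal_le_ofReal
          have : 2 * l / c + 2 * l / c + 2 * l / c = 96 * (C / c) * √ε * r := by
            rw [hl]; field_simp; ring
          rw [this]; gcongr; norm_num

/-- A set of reals which has small density in some ball around each of its points is small. -/
theorem exists_volume_le_of_local : ∃ N : ℝ, 0 ≤ N ∧ ∀ (E : Set ℝ) (A B D η : ℝ), A ≤ B → 0 < D →
    0 ≤ η → E ⊆ Set.Icc A B →
    (∀ x ∈ E, ∃ r, 0 < r ∧ r ≤ D ∧
      volume (E ∩ Metric.closedBall x r) ≤ ENNReal.ofReal (η * r)) →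
    volume E ≤ ENNReal.ofReal (N * η * (B - A + 2 * D)) := by
  obtain ⟨N, τ, hτ, hN⟩ := HasBesicovitchCovering.no_satelliteConfig (α := ℝ)
  refine ⟨N, N.cast_nonneg, fun E A B D η hAB hD hη hE hloc => ?_⟩
  choose! r hr0 hrD hvol using hloc
  let p : Besicovitch.BallPackage E ℝ :=
    { c := fun x => x
      r := fun x => r x
      rpos := fun x => hr0 x x.2
      r_bound := D
      r_le := fun x => hrD x x.2 }
  obtain ⟨s, hdisj, hcov⟩ := Besicovitch.exist_disjoint_covering_families hτ hN p
  have hcount : ∀ i, (s i).Countable := fun i =>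
    (hdisj i).countable_of_nonempty_interior fun j _ => by
      refine Set.Nonempty.mono Metric.ball_subset_interior_closedBall ?_
      exact ⟨_, Metric.mem_ball_self (hr0 j j.2)⟩
  have hfam : ∀ i, volume (⋃ j ∈ s i, E ∩ Metric.closedBall (p.c j) (p.r j)) ≤
      ENNReal.ofReal (η * (B - A + 2 * D)) := by
    intro i
    calc volume (⋃ j ∈ s i, E ∩ Metric.closedBall (p.c j) (p.r j))
        ≤ ∑' j : s i, volume (E ∩ Metric.closedBall (p.c j) (p.r j)) :=
          measure_biUnion_le _ (hcount i) _
      _ ≤ ∑' j : s i, ENNReal.ofReal η * volume (Metric.closedBall (p.c j) (p.r j)) := by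
          refine ENNReal.tsum_le_tsum fun j => ?_
          refine (hvol j.1 j.1.2).trans ?_
          rw [Real.volume_closedBall, ← ENNReal.ofReal_mul hη]
          apply ENNReal.ofReal_le_ofReal
          have := hr0 j.1 j.1.2
          change η * r j.1 ≤ η * (2 * r j.1)
          gcongr; linarith
      _ = ENNReal.ofReal η * volume (⋃ j ∈ s i, Metric.closedBall (p.c j) (p.r j)) := by
          rw [ENNReal.tsum_mul_left, measure_biUnion (hcount i) (hdisj i)
            fun j _ => Metric.isClosed_closedBall.measurableSet]
      _ ≤ ENNReal.ofReal η * volume (Set.Icc (A - D) (B + D)) := by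
          gcongr
          refine Set.iUnion₂_subset fun j _ => ?_
          rw [Real.closedBall_eq_Icc]
          have h1 := hE j.2
          have h2 := hrD j j.2
          exact Set.Icc_subset_Icc (sub_le_sub h1.1 h2) (add_le_add h1.2 h2)
      _ = _ := by
          rw [Real.volume_Icc, ← ENNReal.ofReal_mul hη]; ring_nf
  calc volume E ≤ volume (⋃ i : Fin N, ⋃ j ∈ s i, E ∩ Metric.closedBall (p.c j) (p.r j)) := by
        apply measure_mono
        intro x hx
        have := hcov ⟨⟨x, hx⟩, rfl⟩
        simp only [Set.mem_iUnion] at this ⊢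
        obtain ⟨i, j, hj, h⟩ := this
        exact ⟨i, j, hj, hx, Metric.ball_subset_closedBall h⟩
    _ ≤ ∑ i : Fin N, volume (⋃ j ∈ s i, E ∩ Metric.closedBall (p.c j) (p.r j)) := by
        rw [← tsum_fintype (L := .unconditional _)]; exact measure_iUnion_le _
    _ ≤ ∑ i : Fin N, ENNReal.ofReal (η * (B - A + 2 * D)) := Finset.sum_le_sum fun i _ => hfam i
    _ = _ := by
        rw [Finset.sum_const, Finset.card_univ, Fintype.card_fin, nsmul_eq_mul, mul_assoc,
          ENNReal.ofReal_mul N.cast_nonneg, ENNReal.ofReal_natCast]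

/-- Among a family of open conditions, one can select one that holds on a ball of nearly
maximal radius. -/
theorem exists_near_maximal_ball {ι : Type*} {P : ι → ℝ → Prop} {x R : ℝ}
    (hopen : ∀ s, P s x → ∀ᶠ y in nhds x, P s y) (hx : ∃ s, P s x)
    (hfail : ∀ s, ∃ y ∈ Metric.closedBall x R, ¬ P s y) :
    ∃ s r, 0 < r ∧ r ≤ R ∧ (∀ y ∈ Metric.closedBall x r, P s y) ∧
      ∀ s', ∃ y ∈ Metric.closedBall x (2 * r), ¬ P s' y := by
  set T : Set ℝ := {r | 0 < r ∧ ∃ s, ∀ y ∈ Metric.closedBall x r, P s y} with hT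
  have hTR : ∀ r ∈ T, r ≤ R := by
    rintro r ⟨-, s, hs⟩
    by_contra! h
    obtain ⟨y, hy, hn⟩ := hfail s
    exact hn (hs y (Metric.closedBall_subset_closedBall h.le hy))
  have hTne : T.Nonempty := by
    obtain ⟨s, hs⟩ := hx
    obtain ⟨r, hr, h⟩ := Metric.nhds_basis_closedBall.mem_iff.1 (hopen s hs)
    exact ⟨r, hr, s, fun y hy => h hy⟩
  have hbdd : BddAbove T := ⟨R, hTR⟩
  have hpos : 0 < sSup T := by
    obtain ⟨r, hr⟩ := hTne
    exact hr.1.trans_le (le_csSup hbdd hr)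
  obtain ⟨r, ⟨hr0, s, hs⟩, hlt⟩ := exists_lt_of_lt_csSup hTne (half_lt_self hpos)
  refine ⟨s, r, hr0, hTR r ⟨hr0, s, hs⟩, hs, fun s' => ?_⟩
  by_contra! h
  have := le_csSup hbdd (show 2 * r ∈ T from ⟨by linarith, s', h⟩)
  linarith

section IntegerVectors

open Matrix

/-- An integer vector is primitive if its entries generate the unit ideal. -/
def IsPrimitive (v : Fin 3 → ℤ) : Prop := ∃ u : Fin 3 → ℤ, u ⬝ᵥ v = 1

theorem IsPrimitive.ne_zero {v : Fin 3 → ℤ} (h : IsPrimitive v) : v ≠ 0 := by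
  rintro rfl
  obtain ⟨u, hu⟩ := h
  simp at hu

theorem exists_isPrimitive_smul {v : Fin 3 → ℤ} (hv : v ≠ 0) :
    ∃ (k : ℤ) (w : Fin 3 → ℤ), k ≠ 0 ∧ IsPrimitive w ∧ v = k • w := by
  obtain ⟨w, hw, hg⟩ := Finset.extract_gcd (s := Finset.univ) v Finset.univ_nonempty
  obtain ⟨u, hu⟩ := Finset.gcd_eq_sum_mul .univ w
  refine ⟨Finset.univ.gcd v, w, fun h0 => hv ?_, ⟨u, ?_⟩, ?_⟩
  · ext i
    simp [hw i (Finset.mem_univ i), h0]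
  · rw [dotProduct_comm, dotProduct, ← hu, hg]
  · ext i
    exact hw i (Finset.mem_univ i)

theorem IsPrimitive.eq_smul_of_cross_eq_zero {v w : Fin 3 → ℤ} (hw : IsPrimitive w)
    (h : v ⨯₃ w = 0) : ∃ k : ℤ, v = k • w := by
  obtain ⟨u, hu⟩ := hw
  rw [cross_apply] at h
  have h0 := congrFun h 0
  have h1 := congrFun h 1
  have h2 := congrFun h 2
  simp only [Matrix.cons_val, Pi.zero_apply] at h0 h1 h2
  simp only [vec3_dotProduct] at hu
  refine ⟨u ⬝ᵥ v, ?_⟩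
  ext i
  simp only [vec3_dotProduct, Pi.smul_apply, smul_eq_mul]
  fin_cases i <;> simp only [Fin.zero_eta, Fin.mk_one, Fin.reduceFinMk]
  · linear_combination (-v 0) * hu + u 1 * h2 - u 2 * h1
  · linear_combination (-v 1) * hu - u 0 * h2 + u 2 * h0
  · linear_combination (-v 2) * hu + u 0 * h1 - u 1 * h0

/-- Coordinates of an integer vector, or (for `false`) of an integer covector, in the moving frame
attached to the point `(x, f x)` and the slope `f' x`. -/
def frame (f f' : ℝ → ℝ) : Bool → (Fin 3 → ℤ) → ℝ → Fin 3 → ℝ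
  | true, v, x => ![v 0, v 0 * x - v 1, v 0 * f x - v 2 - f' x * (v 0 * x - v 1)]
  | false, v, x => ![v 0 + v 1 * x + v 2 * f x, -(v 1 + v 2 * f' x), -v 2]

theorem frame_smul (f f' : ℝ → ℝ) (b : Bool) (k : ℤ) (v : Fin 3 → ℤ) (x : ℝ) :
    frame f f' b (k • v) x = (k : ℝ) • frame f f' b v x := by
  cases b <;> ext i <;> fin_cases i <;> simp [frame] <;> ring

theorem frame_dotProduct (f f' : ℝ → ℝ) (b : Bool) (v w : Fin 3 → ℤ) (x : ℝ) :
    frame f f' b v x ⬝ᵥ frame f f' (!b) w x = ((v ⬝ᵥ w : ℤ) : ℝ) := by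
  cases b <;> simp [frame, vec3_dotProduct] <;> ring

theorem frame_cross (f f' : ℝ → ℝ) (b : Bool) (v w : Fin 3 → ℤ) (x : ℝ) :
    frame f f' b v x ⨯₃ frame f f' b w x = frame f f' (!b) (v ⨯₃ w) x := by
  cases b <;> ext i <;> fin_cases i <;> simp [frame, cross_apply] <;> ring

/-- Each coordinate of `u` is smaller than `t` times the corresponding weight. -/
def BoundedBy (w : Fin 3 → ℝ) (t : ℝ) (u : Fin 3 → ℝ) : Prop := ∀ i, |u i| < t * w i

theorem BoundedBy.mono {w u : Fin 3 → ℝ} {s t : ℝ} (hw : ∀ i, 0 < w i) (h : BoundedBy w s u)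
    (hst : s ≤ t) : BoundedBy w t u :=
  fun i => (h i).trans_le (mul_le_mul_of_nonneg_right hst (hw i).le)

theorem BoundedBy.of_smul {w u : Fin 3 → ℝ} {t : ℝ} {k : ℤ} (hk : k ≠ 0)
    (h : BoundedBy w t ((k : ℝ) • u)) : BoundedBy w t u := by
  intro i
  refine lt_of_le_of_lt ?_ (h i)
  have : (1 : ℝ) ≤ |(k : ℝ)| := by exact_mod_cast Int.one_le_abs hk
  simp only [Pi.smul_apply, smul_eq_mul, abs_mul]
  nlinarith [abs_nonneg (u i)]

theorem BoundedBy.abs_dotProduct_lt {w w' u u' : Fin 3 → ℝ} {s t : ℝ}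
    (hww : ∀ i, w i * w' i = 1)
    (h : BoundedBy w s u) (h' : BoundedBy w' t u') : |u ⬝ᵥ u'| < 3 * (s * t) := by
  have hi : ∀ i, |u i * u' i| < s * t := by
    intro i
    rw [abs_mul]
    calc |u i| * |u' i| < (s * w i) * (t * w' i) :=
          mul_lt_mul'' (h i) (h' i) (abs_nonneg _) (abs_nonneg _)
      _ = s * t * (w i * w' i) := by ring
      _ = s * t := by rw [hww, mul_one]
  rw [vec3_dotProduct]
  have h1 := abs_add_three (u 0 * u' 0) (u 1 * u' 1) (u 2 * u' 2)
  linarith [hi 0, hi 1, hi 2]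

theorem BoundedBy.cross {w w' u u' : Fin 3 → ℝ} {s t : ℝ}
    (hww : ∀ i, w i * w' i = 1) (hw : ∀ i, 0 < w i) (hprod : w 0 * w 1 * w 2 = 1)
    (h : BoundedBy w s u) (h' : BoundedBy w t u') : BoundedBy w' (2 * (s * t)) (u ⨯₃ u') := by
  have hm : ∀ i j, |u i * u' j| < s * t * (w i * w j) := by
    intro i j
    rw [abs_mul]
    calc |u i| * |u' j| < (s * w i) * (t * w j) :=
          mul_lt_mul'' (h i) (h' j) (abs_nonneg _) (abs_nonneg _)
      _ = s * t * (w i * w j) := by ring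
  have hij : ∀ i j k, w i * w j * w k = 1 → |u i * u' j - u j * u' i| < 2 * (s * t) * w' k := by
    intro i j k hk
    have e : w i * w j = w' k := by
      have := (hw k).ne'
      apply mul_right_cancel₀ this
      rw [hk, mul_comm, hww]
    have h1 := abs_sub (u i * u' j) (u j * u' i)
    have h2 := hm i j
    have h3 := hm j i
    rw [mul_comm (w j)] at h3
    rw [e] at h2 h3
    linarith
  intro i
  rw [cross_apply]
  fin_cases i
  · simpa using hij 1 2 0 (by linarith)
  · simpa using hij 2 0 1 (by linarith)
  · simpa using hij 0 1 2 (by linarith)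

end IntegerVectors

section ShortVectors

open Matrix

/-- A pair of mutually inverse systems of weights, each of product one. -/
structure IsDualWeights (w : Bool → Fin 3 → ℝ) : Prop where
  pos : ∀ b i, 0 < w b i
  mul_not : ∀ b i, w b i * w (!b) i = 1
  prod : ∀ b, w b 0 * w b 1 * w b 2 = 1

/-- The integer vector (or covector) `s` is shorter than `t` at `x`, relative to the weights `w`. -/
def Short (f f' : ℝ → ℝ) (w : Bool → Fin 3 → ℝ) (s : Bool × (Fin 3 → ℤ)) (t x : ℝ) : Prop :=
  BoundedBy (w s.1) t (frame f f' s.1 s.2 x)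

variable {f f' : ℝ → ℝ} {w : Bool → Fin 3 → ℝ}

theorem Short.eventually {s : Bool × (Fin 3 → ℤ)} {t x : ℝ} (hf : ContinuousAt f x)
    (hf' : ContinuousAt f' x) (h : Short f f' w s t x) : ∀ᶠ y in nhds x, Short f f' w s t y := by
  refine eventually_all.2 fun i => ?_
  have hc : ContinuousAt (fun y => |frame f f' s.1 s.2 y i|) x := by
    obtain ⟨b, v⟩ := s
    cases b <;> fin_cases i <;> simp only [frame, Fin.zero_eta, Fin.mk_one, Fin.reduceFinMk,
      Matrix.cons_val] <;> fun_prop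
  exact hc.eventually_lt continuousAt_const (h i)

theorem Short.of_smul {b : Bool} {k : ℤ} {v : Fin 3 → ℤ} {t x : ℝ} (hk : k ≠ 0)
    (h : Short f f' w (b, k • v) t x) : Short f f' w (b, v) t x := by
  unfold Short at h ⊢
  rw [frame_smul] at h
  exact h.of_smul hk

theorem Short.mono (hw : IsDualWeights w) {s : Bool × (Fin 3 → ℤ)} {t t' x : ℝ}
    (h : Short f f' w s t x) (ht : t ≤ t') : Short f f' w s t' x :=
  BoundedBy.mono (hw.pos _) h ht

theorem Short.cross (hw : IsDualWeights w) {b : Bool} {v v' : Fin 3 → ℤ} {t t' x : ℝ}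
    (h : Short f f' w (b, v) t x) (h' : Short f f' w (b, v') t' x) :
    Short f f' w (!b, v ⨯₃ v') (2 * (t * t')) x := by
  unfold Short at h h' ⊢
  rw [← frame_cross]
  exact BoundedBy.cross (hw.mul_not b) (hw.pos b) (hw.prod b) h h'

theorem Short.dotProduct_eq_zero (hw : IsDualWeights w) {b : Bool} {v v' : Fin 3 → ℤ} {t t' x : ℝ}
    (h : Short f f' w (b, v) t x) (h' : Short f f' w (!b, v') t' x) (htt : 3 * (t * t') ≤ 1) :
    v ⬝ᵥ v' = 0 := by
  have h1 := BoundedBy.abs_dotProduct_lt (hw.mul_not b) h h'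
  rw [frame_dotProduct] at h1
  have h2 : |((v ⬝ᵥ v' : ℤ) : ℝ)| < 1 := h1.trans_le htt
  exact Int.abs_lt_one_iff.1 (by exact_mod_cast h2)

/-- Two short vectors which are both orthogonal to a vector that is not short are parallel. -/
theorem Short.of_orthogonal (hw : IsDualWeights w) {b : Bool} {v u u' : Fin 3 → ℤ} {ε y : ℝ}
    (hv : IsPrimitive v) (hu : IsPrimitive u) (hu' : IsPrimitive u')
    (hvu : v ⬝ᵥ u = 0) (hvu' : v ⬝ᵥ u' = 0) (hε : 0 < ε)
    (h : Short f f' w (!b, u) (1 / 4) y) (h' : Short f f' w (!b, u') ε y)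
    (hn : ¬ Short f f' w (b, v) ε y) : Short f f' w (!b, u) ε y := by
  by_cases hc : u' ⨯₃ u = 0
  · obtain ⟨k, rfl⟩ := hu.eq_smul_of_cross_eq_zero hc
    have hk : k ≠ 0 := by
      rintro rfl
      exact hu'.ne_zero (zero_smul _ _)
    exact h'.of_smul hk
  · exfalso
    have hpar : (u' ⨯₃ u) ⨯₃ v = 0 := by
      rw [cross_cross_eq_smul_sub_smul, dotProduct_comm u' v, dotProduct_comm u v, hvu, hvu']
      simp
    obtain ⟨k, hk⟩ := hv.eq_smul_of_cross_eq_zero hpar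
    have hk0 : k ≠ 0 := by
      rintro rfl
      exact hc (by rw [hk, zero_smul])
    have h2 := h'.cross hw h
    rw [hk, Bool.not_not] at h2
    exact hn ((h2.of_smul hk0).mono hw (by linarith))

variable {α β R ε η : ℝ}

/-- The set where a given vector is not short, yet some vector orthogonal to it is, has small
measure in a ball of nearly maximal radius. -/
theorem volume_orthogonal_short_le {N : ℝ} (hw : IsDualWeights w)
    (hN : ∀ (E : Set ℝ) (A B D η : ℝ), A ≤ B → 0 < D →
      0 ≤ η → E ⊆ Set.Icc A B →
      (∀ x ∈ E, ∃ r, 0 < r ∧ r ≤ D ∧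
        volume (E ∩ Metric.closedBall x r) ≤ ENNReal.ofReal (η * r)) →
      volume E ≤ ENNReal.ofReal (N * η * (B - A + 2 * D)))
    (hcont : ∀ x ∈ Set.Icc α β, ContinuousAt f x ∧ ContinuousAt f' x)
    (hε : 0 < ε) (hε' : ε ≤ 1 / 8) (hη : 0 ≤ η)
    (hgood : ∀ s : Bool × (Fin 3 → ℤ), IsPrimitive s.2 → ∀ x ∈ Set.Icc α β, ∀ r, 0 < r →
      r ≤ 3 * R → (∃ y ∈ Metric.closedBall x (2 * r), ¬ Short f f' w s (1 / 4) y) →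
      volume {y ∈ Metric.closedBall x r | Short f f' w s ε y} ≤ ENNReal.ofReal (η * r))
    {b : Bool} {v : Fin 3 → ℤ} (hv : IsPrimitive v) {x₀ r₀ : ℝ} (hr₀ : 0 < r₀) (hr₀R : r₀ ≤ R)
    (hmax : ∀ s : Bool × (Fin 3 → ℤ), IsPrimitive s.2 →
      ∃ y ∈ Metric.closedBall x₀ (2 * r₀), ¬ Short f f' w s (1 / 4) y) :
    volume {y ∈ Metric.closedBall x₀ r₀ ∩ Set.Icc α β | ¬ Short f f' w (b, v) ε y ∧
      ∃ u, IsPrimitive u ∧ v ⬝ᵥ u = 0 ∧ Short f f' w (!b, u) ε y} ≤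
      ENNReal.ofReal (8 * N * η * r₀) := by
  have key := hN {y ∈ Metric.closedBall x₀ r₀ ∩ Set.Icc α β | ¬ Short f f' w (b, v) ε y ∧
      ∃ u, IsPrimitive u ∧ v ⬝ᵥ u = 0 ∧ Short f f' w (!b, u) ε y} (x₀ - r₀) (x₀ + r₀) (3 * r₀) η
      (by linarith) (by linarith) hη (fun y hy => by
        have := hy.1.1
        rwa [Real.closedBall_eq_Icc] at this) ?_
  · refine key.trans_eq ?_
    ring_nf
  rintro x ⟨⟨hx, hxI⟩, -, u₀, hu₀, hvu₀, hsu₀⟩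
  obtain ⟨⟨u, hu, hvu⟩, r, hr, hrR, hball, hmax'⟩ := exists_near_maximal_ball
    (ι := {u : Fin 3 → ℤ // IsPrimitive u ∧ v ⬝ᵥ u = 0})
    (P := fun u y => Short f f' w (!b, u.1) (1 / 4) y) (x := x) (R := 3 * r₀)
    (fun s hs => hs.eventually (hcont x hxI).1 (hcont x hxI).2)
    ⟨⟨u₀, hu₀, hvu₀⟩, hsu₀.mono hw (by linarith)⟩
    (fun s => by
      obtain ⟨y, hy, hn⟩ := hmax (!b, s.1) s.2.1
      refine ⟨y, ?_, hn⟩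
      have := Metric.closedBall_subset_closedBall' (x := x₀) (y := x) (ε₁ := 2 * r₀) (ε₂ := 3 * r₀)
        (by rw [dist_comm]; linarith [Metric.mem_closedBall.1 hx])
      exact this hy)
  refine ⟨r, hr, hrR, (measure_mono ?_).trans
    (hgood (!b, u) hu x hxI r hr (by linarith) (hmax' ⟨u, hu, hvu⟩))⟩
  rintro y ⟨⟨-, hn, u', hu', hvu', hs'⟩, hyr⟩
  exact ⟨hyr, Short.of_orthogonal hw hv hu hu' hvu hvu' hε (hball y hyr) hs' hn⟩

/-- The set of points at which some nonzero integer vector or covector is short has small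
measure. -/
theorem volume_short_le {N : ℝ} (hw : IsDualWeights w) (hN0 : 0 ≤ N)
    (hN : ∀ (E : Set ℝ) (A B D η : ℝ), A ≤ B → 0 < D →
      0 ≤ η → E ⊆ Set.Icc A B →
      (∀ x ∈ E, ∃ r, 0 < r ∧ r ≤ D ∧
        volume (E ∩ Metric.closedBall x r) ≤ ENNReal.ofReal (η * r)) →
      volume E ≤ ENNReal.ofReal (N * η * (B - A + 2 * D)))
    (hαβ : α ≤ β) (hR : 0 < R)
    (hcont : ∀ x ∈ Set.Icc α β, ContinuousAt f x ∧ ContinuousAt f' x)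
    (hε : 0 < ε) (hε' : ε ≤ 1 / 8) (hη : 0 ≤ η)
    (hgood : ∀ s : Bool × (Fin 3 → ℤ), IsPrimitive s.2 → ∀ x ∈ Set.Icc α β, ∀ r, 0 < r →
      r ≤ 3 * R → (∃ y ∈ Metric.closedBall x (2 * r), ¬ Short f f' w s (1 / 4) y) →
      volume {y ∈ Metric.closedBall x r | Short f f' w s ε y} ≤ ENNReal.ofReal (η * r))
    (hfail : ∀ s : Bool × (Fin 3 → ℤ), IsPrimitive s.2 → ∀ x ∈ Set.Icc α β,
      ∃ y ∈ Metric.closedBall x R, ¬ Short f f' w s (1 / 4) y) :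
    volume {x ∈ Set.Icc α β | ∃ s : Bool × (Fin 3 → ℤ), s.2 ≠ 0 ∧ Short f f' w s ε x} ≤
      ENNReal.ofReal (N * (1 + 8 * N) * η * (β - α + 2 * R)) := by
  have hprim : ∀ x, (∃ s : Bool × (Fin 3 → ℤ), s.2 ≠ 0 ∧ Short f f' w s ε x) →
      ∃ b v, IsPrimitive v ∧ Short f f' w (b, v) ε x := by
    rintro x ⟨⟨b, v⟩, hv, hs⟩
    obtain ⟨k, v', hk, hv', rfl⟩ := exists_isPrimitive_smul hv
    exact ⟨b, v', hv', hs.of_smul hk⟩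
  have key := hN {x ∈ Set.Icc α β | ∃ s : Bool × (Fin 3 → ℤ), s.2 ≠ 0 ∧ Short f f' w s ε x}
    α β R ((1 + 8 * N) * η) hαβ hR (by positivity) (fun y hy => hy.1) ?_
  · refine key.trans_eq ?_
    ring_nf
  rintro x ⟨hxI, hx⟩
  obtain ⟨b₀, v₀, hv₀, hs₀⟩ := hprim x hx
  obtain ⟨⟨⟨b, v⟩, hv⟩, r, hr, hrR, hball, hmax⟩ := exists_near_maximal_ball
    (ι := {s : Bool × (Fin 3 → ℤ) // IsPrimitive s.2})
    (P := fun s y => Short f f' w s.1 (1 / 4) y) (x := x) (R := R)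
    (fun s hs => hs.eventually (hcont x hxI).1 (hcont x hxI).2)
    ⟨⟨(b₀, v₀), hv₀⟩, hs₀.mono hw (by linarith)⟩ (fun s => hfail s.1 s.2 x hxI)
  refine ⟨r, hr, hrR, ?_⟩
  have h1 := hgood (b, v) hv x hxI r hr (by linarith) (hmax ⟨(b, v), hv⟩)
  have h2 := volume_orthogonal_short_le hw hN hcont hε hε' hη hgood (b := b) hv hr hrR
    (fun s hs => hmax ⟨s, hs⟩)
  calc _ ≤ volume ({y ∈ Metric.closedBall x r | Short f f' w (b, v) ε y} ∪
        {y ∈ Metric.closedBall x r ∩ Set.Icc α β | ¬ Short f f' w (b, v) ε y ∧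
          ∃ u, IsPrimitive u ∧ v ⬝ᵥ u = 0 ∧ Short f f' w (!b, u) ε y}) := by
        apply measure_mono
        rintro y ⟨⟨hyI, hy⟩, hyr⟩
        by_cases hn : Short f f' w (b, v) ε y
        · exact Or.inl ⟨hyr, hn⟩
        refine Or.inr ⟨⟨hyr, hyI⟩, hn, ?_⟩
        obtain ⟨b', u, hu, hsu⟩ := hprim y hy
        have hvy := hball y hyr
        obtain rfl | rfl : b' = b ∨ b' = !b := by cases b <;> cases b' <;> simp
        · have hc := hvy.cross hw hsu
          have hne : v ⨯₃ u ≠ 0 := by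
            intro h0
            have h0' : u ⨯₃ v = 0 := by rw [← cross_anticomm, h0, neg_zero]
            obtain ⟨k, rfl⟩ := IsPrimitive.eq_smul_of_cross_eq_zero hv h0'
            refine hn (hsu.of_smul ?_)
            rintro rfl
            exact hu.ne_zero (zero_smul _ _)
          obtain ⟨k, z, hk, hz, hvz⟩ := exists_isPrimitive_smul hne
          rw [hvz] at hc
          refine ⟨z, hz, ?_, (hc.of_smul hk).mono hw (by linarith)⟩
          have h3 : v ⬝ᵥ v ⨯₃ u = 0 := dot_self_cross v u
          rw [hvz, dotProduct_smul, smul_eq_mul] at h3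
          exact (mul_eq_zero.1 h3).resolve_left hk
        · exact ⟨u, hu, hvy.dotProduct_eq_zero hw hsu (by linarith), hsu⟩
    _ ≤ ENNReal.ofReal (η * r) + ENNReal.ofReal (8 * N * η * r) :=
        (measure_union_le _ _).trans (add_le_add h1 h2)
    _ = _ := by
        rw [← ENNReal.ofReal_add (by positivity) (by positivity)]; ring_nf

end ShortVectors

section Curvature

/-- The weights `Q, δ, ψ` and their inverses. -/
noncomputable def dualWeights (Q δ ψ : ℝ) : Bool → Fin 3 → ℝ
  | true => ![Q, δ, ψ]
  | false => ![Q⁻¹, δ⁻¹, ψ⁻¹]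

theorem isDualWeights_dualWeights {Q δ ψ : ℝ} (hQ : 0 < Q) (hδ : 0 < δ) (hψ : 0 < ψ)
    (h : Q * δ * ψ = 1) : IsDualWeights (dualWeights Q δ ψ) where
  pos b i := by cases b <;> fin_cases i <;> simpa [dualWeights]
  mul_not b i := by
    cases b <;> fin_cases i <;> simp [dualWeights, hQ.ne', hδ.ne', hψ.ne']
  prod b := by
    cases b
    · change Q⁻¹ * δ⁻¹ * ψ⁻¹ = 1
      rw [← mul_inv, ← mul_inv, h, inv_one]
    · simpa [dualWeights] using h

/-- `f'` and `f''` are the first two derivatives of `f` on `s`, and `|f''|` lies in `[c, C]`. -/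
structure HasCurvature (f f' f'' : ℝ → ℝ) (c C : ℝ) (s : Set ℝ) : Prop where
  hasDerivAt : ∀ x ∈ s, HasDerivAt f (f' x) x
  hasDerivAt' : ∀ x ∈ s, HasDerivAt f' (f'' x) x
  le_abs : ∀ x ∈ s, c ≤ |f'' x|
  abs_le : ∀ x ∈ s, |f'' x| ≤ C

theorem HasCurvature.mono {f f' f'' : ℝ → ℝ} {c C : ℝ} {s t : Set ℝ}
    (h : HasCurvature f f' f'' c C s) (hts : t ⊆ s) : HasCurvature f f' f'' c C t :=
  ⟨fun x hx => h.1 x (hts hx), fun x hx => h.2 x (hts hx), fun x hx => h.3 x (hts hx),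
    fun x hx => h.4 x (hts hx)⟩

theorem HasCurvature.monotoneOn_or_antitoneOn {f f' f'' : ℝ → ℝ} {c C : ℝ} {s : Set ℝ}
    (h : HasCurvature f f' f'' c C s) (hs : Convex ℝ s) (hc : 0 < c) :
    MonotoneOn f' s ∨ AntitoneOn f' s := by
  have hcont : ContinuousOn f' s := fun x hx => (h.2 x hx).continuousAt.continuousWithinAt
  rcases hasDerivWithinAt_forall_lt_or_forall_gt_of_forall_ne hs
    (fun x hx => (h.2 x hx).hasDerivWithinAt) (m := 0)
    (fun x hx h0 => by have := h.3 x hx; rw [h0, abs_zero] at this; linarith) with hlt | hgt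
  · exact Or.inr (antitoneOn_of_hasDerivWithinAt_nonpos hs hcont
      (fun x hx => (h.2 x (interior_subset hx)).hasDerivWithinAt)
      fun x hx => (hlt x (interior_subset hx)).le)
  · exact Or.inl (monotoneOn_of_hasDerivWithinAt_nonneg hs hcont
      (fun x hx => (h.2 x (interior_subset hx)).hasDerivWithinAt)
      fun x hx => (hgt x (interior_subset hx)).le)

variable {f f' f'' : ℝ → ℝ} {c C : ℝ}

theorem HasCurvature.volume_short_closedBall_le {w : Bool → Fin 3 → ℝ} {x r ε : ℝ}
    (h : HasCurvature f f' f'' c C (Metric.closedBall x (2 * r))) (hc : 0 < c) (hc1 : c ≤ 1)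
    (hC1 : 1 ≤ C) (hw : ∀ b i, 0 < w b i) (hr : 0 < r) (hε : 0 < ε) (hε' : ε ≤ 1 / 8)
    (s : Bool × (Fin 3 → ℤ))
    (hs : ∃ y ∈ Metric.closedBall x (2 * r), ¬ Short f f' w s (1 / 4) y) :
    volume {y ∈ Metric.closedBall x r | Short f f' w s ε y} ≤
      ENNReal.ofReal (128 * (C / c) * √ε * r) := by
  have hball : Metric.closedBall x (2 * r) = Set.Icc (x - 2 * r) (x + 2 * r) :=
    Real.closedBall_eq_Icc
  have hord : (Metric.closedBall x (2 * r)).OrdConnected := by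
    rw [hball]; exact Set.ordConnected_Icc
  have hconv : Convex ℝ (Metric.closedBall x (2 * r)) := convex_closedBall _ _
  rcases Set.eq_empty_or_nonempty {y ∈ Metric.closedBall x r | Short f f' w s ε y} with
    he | ⟨y₁, -, hy₁⟩
  · rw [he]; simp
  obtain ⟨y₀, hy₀, hn⟩ := hs
  unfold Short BoundedBy at hn
  push Not at hn
  obtain ⟨i, hi⟩ := hn
  obtain ⟨b, v⟩ := s
  have hpos := hw b
  have hsame : ∀ j, |frame f f' b v y₁ j| = |frame f f' b v y₀ j| → i ≠ j := by
    rintro j hj rfl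
    have h1 := hy₁ i
    simp only at h1 hi
    rw [hj] at h1
    nlinarith [hpos i]
  cases b
  · refine le_trans (measure_mono ?_) (volume_sublevel_le (x := x) (r := r) (ε := ε)
      (c := c) (C := C) (M := |(v 2 : ℝ)|)
      (Y := fun y => -(v 1 + v 2 * f' y)) (Z := fun y => v 0 + v 1 * y + v 2 * f y)
      (g := fun _ => -1) (w₁ := w false 1) (w₂ := w false 0) hc (hc1.trans hC1) hr (abs_nonneg _)
      (hpos 1) (hpos 0) hε hε' ?_ ?_ ?_ ?_ ?_ ?_)
    · rintro y ⟨hy, hys⟩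
      exact ⟨hy, hys 1, hys 0⟩
    · intro y hy z hz
      obtain ⟨ξ, hξ, e⟩ := exists_slope_eq hord h.2 hy hz
      have : -(v 1 + v 2 * f' y) - -(v 1 + v 2 * f' z) = -(v 2 * (f'' ξ * (y - z))) := by
        rw [← e]; ring
      rw [this, abs_neg, abs_mul, abs_mul]
      have := h.3 ξ (hord.uIcc_subset hy hz hξ)
      calc c * |(v 2 : ℝ)| * |y - z| = |(v 2 : ℝ)| * (c * |y - z|) := by ring
        _ ≤ _ := by gcongr
    · intro y hy z hz
      obtain ⟨ξ, hξ, e⟩ := exists_slope_eq hord h.2 hy hz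
      have : -(v 1 + v 2 * f' y) - -(v 1 + v 2 * f' z) = -(v 2 * (f'' ξ * (y - z))) := by
        rw [← e]; ring
      rw [this, abs_neg, abs_mul, abs_mul]
      have := h.4 ξ (hord.uIcc_subset hy hz hξ)
      calc |(v 2 : ℝ)| * (|f'' ξ| * |y - z|) ≤ |(v 2 : ℝ)| * (C * |y - z|) := by gcongr
        _ = _ := by ring
    · rcases h.monotoneOn_or_antitoneOn hconv hc with hm | hm <;>
        rcases le_total (v 2 : ℝ) 0 with hv | hv
      · exact Or.inl fun y hy z hz hyz => by
          have := mul_le_mul_of_nonpos_left (hm hy hz hyz) hv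
          dsimp only; linarith
      · exact Or.inr fun y hy z hz hyz => by
          have := mul_le_mul_of_nonneg_left (hm hy hz hyz) hv
          dsimp only; linarith
      · exact Or.inr fun y hy z hz hyz => by
          have := mul_le_mul_of_nonpos_left (hm hy hz hyz) hv
          dsimp only; linarith
      · exact Or.inl fun y hy z hz hyz => by
          have := mul_le_mul_of_nonneg_left (hm hy hz hyz) hv
          dsimp only; linarith
    · intro y hy
      have := (((hasDerivAt_id y).const_mul (v 1 : ℝ)).const_add (v 0 : ℝ)).add
        ((h.1 y hy).const_mul (v 2 : ℝ))
      exact HasDerivAt.congr_deriv this (by ring)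
    · intro y hy
      simp only [abs_neg, abs_one]
      exact ⟨hc1, hC1⟩
    · refine ⟨y₀, hy₀, ?_⟩
      have hi2 : i ≠ 2 := hsame 2 rfl
      fin_cases i
      · exact Or.inr hi
      · exact Or.inl hi
      · exact absurd rfl hi2
  · refine le_trans (measure_mono ?_) (volume_sublevel_le (x := x) (r := r) (ε := ε)
      (c := c) (C := C) (M := |(v 0 : ℝ)|)
      (Y := fun y => v 0 * y - v 1) (Z := fun y => v 0 * f y - v 2 - f' y * (v 0 * y - v 1))
      (g := fun y => -f'' y) (w₁ := w true 1) (w₂ := w true 2) hc (hc1.trans hC1) hr (abs_nonneg _)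
      (hpos 1) (hpos 2) hε hε' ?_ ?_ ?_ ?_ ?_ ?_)
    · rintro y ⟨hy, hys⟩
      exact ⟨hy, hys 1, hys 2⟩
    · intro y hy z hz
      rw [show (v 0 : ℝ) * y - v 1 - (v 0 * z - v 1) = v 0 * (y - z) by ring, abs_mul]
      rw [mul_assoc]
      exact mul_le_of_le_one_left (by positivity) hc1
    · intro y hy z hz
      rw [show (v 0 : ℝ) * y - v 1 - (v 0 * z - v 1) = v 0 * (y - z) by ring, abs_mul]
      rw [mul_assoc]
      exact le_mul_of_one_le_left (by positivity) hC1
    · rcases le_total (v 0 : ℝ) 0 with hv | hv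
      · exact Or.inr fun y hy z hz hyz => by
          have := mul_le_mul_of_nonpos_left hyz hv
          dsimp only; linarith
      · exact Or.inl fun y hy z hz hyz => by
          have := mul_le_mul_of_nonneg_left hyz hv
          dsimp only; linarith
    · intro y hy
      have := (((h.1 y hy).const_mul (v 0 : ℝ)).sub_const (v 2 : ℝ)).sub
        ((h.2 y hy).mul (((hasDerivAt_id y).const_mul (v 0 : ℝ)).sub_const (v 1 : ℝ)))
      refine HasDerivAt.congr_deriv this ?_
      simp only [id]
      ring
    · intro y hy
      simp only [abs_neg]
      exact ⟨h.3 y hy, h.4 y hy⟩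
    · refine ⟨y₀, hy₀, ?_⟩
      have hi2 : i ≠ 0 := hsame 0 rfl
      fin_cases i
      · exact absurd rfl hi2
      · exact Or.inl hi
      · exact Or.inr hi

theorem Int.eq_zero_of_abs_cast_lt_one {n : ℤ} (h : |(n : ℝ)| < 1) : n = 0 :=
  Int.abs_lt_one_iff.1 (by exact_mod_cast h)

/-- No nonzero integer vector or covector is short on a whole ball of fixed radius. -/
theorem HasCurvature.exists_not_short {Q δ ψ x R : ℝ}
    (h : HasCurvature f f' f'' c C (Metric.closedBall x R)) (hc : 0 < c) (hR : 0 < R)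
    (hδR : δ ≤ R) (hδ1 : δ ≤ 1) (hψ1 : ψ ≤ 1) (hQ1 : 1 ≤ Q) (hQR : 1 ≤ Q * R)
    (hQR2 : 2 < c * Q * R ^ 2) (s : Bool × (Fin 3 → ℤ)) (hs : s.2 ≠ 0) :
    ∃ y ∈ Metric.closedBall x R, ¬ Short f f' (dualWeights Q δ ψ) s (1 / 4) y := by
  by_contra! hall
  apply hs
  obtain ⟨b, v⟩ := s
  have hball : Metric.closedBall x R = Set.Icc (x - R) (x + R) := Real.closedBall_eq_Icc
  have hord : (Metric.closedBall x R).OrdConnected := by rw [hball]; exact Set.ordConnected_Icc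
  have hmem : ∀ t, -R ≤ t → t ≤ R → x + t ∈ Metric.closedBall x R := by
    intro t h1 h2
    rw [hball]; constructor <;> linarith
  have hQi : Q⁻¹ ≤ 1 := inv_le_one_of_one_le₀ hQ1
  have hQiR : Q⁻¹ ≤ R := by
    rw [inv_le_iff_one_le_mul₀ (by linarith)]; linarith
  cases b
  · have hF : ∀ t, -R ≤ t → t ≤ R →
        |v 0 + v 1 * (x + t) + v 2 * f (x + t)| < 1 / 4 * Q⁻¹ :=
      fun t h1 h2 => hall _ (hmem t h1 h2) 0
    have hd : ∀ y ∈ Metric.closedBall x R,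
        HasDerivAt (fun y => v 0 + v 1 * y + v 2 * f y) (v 1 + v 2 * f' y) y := by
      intro y hy
      have := (((hasDerivAt_id y).const_mul (v 1 : ℝ)).const_add (v 0 : ℝ)).add
        ((h.1 y hy).const_mul (v 2 : ℝ))
      exact HasDerivAt.congr_deriv this (by ring)
    have hslope : ∀ t, -R ≤ t → t + R / 2 ≤ R → ∃ ξ, x + t ≤ ξ ∧ ξ ≤ x + t + R / 2 ∧
        |v 1 + v 2 * f' ξ| ≤ Q⁻¹ / R := by
      intro t h1 h2
      obtain ⟨ξ, hξ, e⟩ := exists_slope_eq hord hd (hmem t h1 (by linarith))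
        (hmem (t + R / 2) (by linarith) h2)
      rw [Set.uIcc_of_le (by linarith)] at hξ
      refine ⟨ξ, hξ.1, by linarith [hξ.2], ?_⟩
      have e1 := hF t h1 (by linarith)
      have e2 := hF (t + R / 2) (by linarith) h2
      have e3 := (abs_sub (v 0 + v 1 * (x + t) + v 2 * f (x + t))
        (v 0 + v 1 * (x + (t + R / 2)) + v 2 * f (x + (t + R / 2))))
      rw [e, abs_mul, show x + t - (x + (t + R / 2)) = -(R / 2) by ring, abs_neg,
        abs_of_pos (half_pos hR)] at e3
      rw [le_div_iff₀ hR]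
      linarith
    obtain ⟨ξ₁, a1, b1, k1⟩ := hslope (-R) le_rfl (by linarith)
    obtain ⟨ξ₂, a2, b2, k2⟩ := hslope (R / 2) (by linarith) (by linarith)
    have hm1 : ξ₁ ∈ Metric.closedBall x R := by rw [hball]; constructor <;> linarith
    have hm2 : ξ₂ ∈ Metric.closedBall x R := by rw [hball]; constructor <;> linarith
    obtain ⟨ζ, hζ, e⟩ := exists_slope_eq hord h.2 hm2 hm1
    have hcz := h.3 ζ (hord.uIcc_subset hm2 hm1 hζ)
    have e3 := abs_sub (v 1 + v 2 * f' ξ₂) (v 1 + v 2 * f' ξ₁)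
    rw [show (v 1 + v 2 * f' ξ₂) - (v 1 + v 2 * f' ξ₁) = v 2 * (f'' ζ * (ξ₂ - ξ₁)) by
      rw [← e]; ring, abs_mul, abs_mul, abs_of_pos (by linarith : 0 < ξ₂ - ξ₁)] at e3
    have h2 : v 2 = 0 := by
      apply Int.eq_zero_of_abs_cast_lt_one
      have e4 : |(v 2 : ℝ)| * (c * R) ≤ |(v 2 : ℝ)| * (|f'' ζ| * (ξ₂ - ξ₁)) := by
        gcongr; linarith
      have e5 : |(v 2 : ℝ)| * (c * R) ≤ 2 * (Q⁻¹ / R) := by linarith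
      have e6 : 2 * (Q⁻¹ / R) < c * R := by
        have : Q⁻¹ / R = 1 / (Q * R) := by field_simp
        rw [this, mul_one_div, div_lt_iff₀ (by positivity)]
        nlinarith
      have : |(v 2 : ℝ)| * (c * R) < 1 * (c * R) := by linarith
      exact lt_of_mul_lt_mul_right this (by positivity)
    have h1 : v 1 = 0 := by
      apply Int.eq_zero_of_abs_cast_lt_one
      have e1 := hF R (by linarith) le_rfl
      have e2 := hF (-R) le_rfl (by linarith)
      have e3 := abs_sub (v 0 + v 1 * (x + R) + v 2 * f (x + R))
        (v 0 + v 1 * (x + -R) + v 2 * f (x + -R))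
      rw [h2, Int.cast_zero, zero_mul, zero_mul] at e3
      rw [h2, Int.cast_zero, zero_mul] at e1 e2
      rw [show v 0 + v 1 * (x + R) + 0 - (v 0 + v 1 * (x + -R) + 0) = v 1 * (2 * R) by ring,
        abs_mul, abs_of_pos (by linarith : 0 < 2 * R)] at e3
      nlinarith
    have h0 : v 0 = 0 := by
      apply Int.eq_zero_of_abs_cast_lt_one
      have e1 := hF 0 (by linarith) hR.le
      rw [h2, h1, Int.cast_zero, zero_mul, zero_mul, add_zero, add_zero] at e1
      linarith
    ext i
    fin_cases i <;> assumption
  · have hY : ∀ t, -R ≤ t → t ≤ R → |v 0 * (x + t) - v 1| < 1 / 4 * δ :=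
      fun t h1 h2 => hall _ (hmem t h1 h2) 1
    have h0 : v 0 = 0 := by
      apply Int.eq_zero_of_abs_cast_lt_one
      have e1 := hY R (by linarith) le_rfl
      have e2 := hY (-R) le_rfl (by linarith)
      have e3 := abs_sub (v 0 * (x + R) - v 1) (v 0 * (x + -R) - v 1)
      rw [show v 0 * (x + R) - v 1 - (v 0 * (x + -R) - v 1) = v 0 * (2 * R) by ring,
        abs_mul, abs_of_pos (by linarith : 0 < 2 * R)] at e3
      nlinarith
    have h1 : v 1 = 0 := by
      apply Int.eq_zero_of_abs_cast_lt_one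
      have e1 := hY 0 (by linarith) hR.le
      rw [h0, Int.cast_zero, zero_mul, zero_sub, abs_neg] at e1
      linarith
    have h2 : v 2 = 0 := by
      apply Int.eq_zero_of_abs_cast_lt_one
      have e1 : |v 0 * f (x + 0) - v 2 - f' (x + 0) * (v 0 * (x + 0) - v 1)| < 1 / 4 * ψ :=
        hall _ (hmem 0 (by linarith) hR.le) 2
      rw [h0, h1, Int.cast_zero, zero_mul, zero_mul, zero_sub, sub_zero, mul_zero, sub_zero,
        abs_neg] at e1
      linarith
    ext i
    fin_cases i <;> assumption

/-- Away from a set of small measure, no nonzero integer vector is short. -/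
theorem HasCurvature.exists_volume_short_le {α β m : ℝ} (hαβ : α < β) (hm : 0 < m) (hc : 0 < c)
    (hc1 : c ≤ 1) (hC1 : 1 ≤ C) (h : HasCurvature f f' f'' c C (Set.Icc (α - m) (β + m))) :
    ∃ ε > 0, ε ≤ 1 / 8 ∧ ∃ T ≥ 1, ∀ Q δ ψ : ℝ, 0 < δ → 0 < ψ → Q * δ * ψ = 1 → T ≤ Q →
      δ ≤ T⁻¹ → ψ ≤ 1 →
      volume {x ∈ Set.Icc α β | ∃ v : Fin 3 → ℤ, v ≠ 0 ∧
        Short f f' (dualWeights Q δ ψ) (true, v) ε x} ≤ ENNReal.ofReal ((β - α) / 2) := by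
  obtain ⟨N, hN0, hN⟩ := exists_volume_le_of_local
  set R := m / 6 with hR
  have hR0 : 0 < R := by positivity
  have hC0 : 0 < C := by linarith
  set X := N * (1 + 8 * N) * (128 * (C / c)) * (β - α + 2 * R) with hX
  have hba : 0 < β - α := by linarith
  have hX0 : 0 ≤ X := by positivity
  set e := (β - α) / (2 * (X + 1)) with he
  have he0 : 0 < e := by positivity
  set T := max 1 (max R⁻¹ (3 / (c * R ^ 2))) with hT
  have hT1 : 1 ≤ T := le_max_left _ _
  refine ⟨min (1 / 8) (e ^ 2), by positivity, min_le_left _ _, T, hT1, ?_⟩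
  intro Q δ ψ hδ hψ hprod hTQ hδT hψ1
  set ε := min (1 / 8) (e ^ 2) with hε
  have hε0 : 0 < ε := by positivity
  have hsε : √ε ≤ e := by
    rw [Real.sqrt_le_left he0.le]; exact min_le_right _ _
  have hQ : 0 < Q := by linarith
  have hTR : R⁻¹ ≤ T := (le_max_left _ _).trans (le_max_right _ _)
  have hTc : 3 / (c * R ^ 2) ≤ T := (le_max_right _ _).trans (le_max_right _ _)
  have hsub : ∀ x ∈ Set.Icc α β, ∀ r ≤ m, Metric.closedBall x r ⊆ Set.Icc (α - m) (β + m) := by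
    intro x hx r hr
    rw [Real.closedBall_eq_Icc]
    exact Set.Icc_subset_Icc (by linarith [hx.1]) (by linarith [hx.2])
  have key := volume_short_le (f := f) (f' := f') (α := α) (β := β) (R := R) (ε := ε)
    (η := 128 * (C / c) * √ε) (isDualWeights_dualWeights hQ hδ hψ hprod) hN0 hN hαβ.le hR0
    (fun x hx => by
      have hx' : x ∈ Set.Icc (α - m) (β + m) := ⟨by linarith [hx.1], by linarith [hx.2]⟩
      exact ⟨(h.1 x hx').continuousAt, (h.2 x hx').continuousAt⟩)
    hε0 (min_le_left _ _) (by positivity)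
    (fun s hs x hx r hr hrR hn => by
      refine HasCurvature.volume_short_closedBall_le (h.mono (hsub x hx _ (by linarith))) hc hc1 hC1
        (isDualWeights_dualWeights hQ hδ hψ hprod).pos hr hε0 (min_le_left _ _) s hn)
    (fun s hs x hx => by
      refine HasCurvature.exists_not_short (h.mono (hsub x hx _ (by linarith))) hc hR0 ?_ ?_ hψ1
        (hT1.trans hTQ) ?_ ?_ s hs.ne_zero
      · refine hδT.trans ?_
        rw [inv_le_comm₀ (by linarith) hR0]; exact hTR
      · exact hδT.trans (inv_le_one_of_one_le₀ hT1)
      · have := hTR.trans hTQ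
        rwa [inv_le_iff_one_le_mul₀ hR0] at this
      · have := hTc.trans hTQ
        rw [div_le_iff₀ (by positivity)] at this
        linarith)
  refine (measure_mono ?_).trans (key.trans (ENNReal.ofReal_le_ofReal ?_))
  · rintro x ⟨hx, v, hv, hs⟩
    exact ⟨hx, (true, v), hv, hs⟩
  · calc N * (1 + 8 * N) * (128 * (C / c) * √ε) * (β - α + 2 * R) = X * √ε := by
          rw [hX]; ring
      _ ≤ (X + 1) * e := by gcongr; linarith
      _ = (β - α) / 2 := by rw [he]; field_simp

/-- A weighted form of Dirichlet's theorem on simultaneous approximation. -/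
theorem exists_simultaneous_approx {Q a d : ℝ} (ha : 0 < a) (hd : 0 < d) (ha1 : a ≤ 1)
    (hd1 : d ≤ 1) (hQ : 4 ≤ a * d * Q) (x y t : ℝ) :
    ∃ q p₁ p₂ : ℤ, 1 ≤ q ∧ (q : ℝ) ≤ Q ∧ |q * x - p₁| < a ∧
      |q * y - p₂ - t * (q * x - p₁)| < d := by
  have hQ0 : 0 < Q := by
    by_contra! hneg
    nlinarith [mul_pos ha hd]
  set n := ⌊Q⌋₊ with hn
  set Y : ℕ → ℝ := fun k => Int.fract (k * x) with hY
  set Z : ℕ → ℝ := fun k => k * y - t * Y k with hZ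
  set A := ⌊1 / a⌋₊ + 1 with hA
  set B := ⌊1 / d⌋₊ + 1 with hB
  have hbox : ∀ e : ℝ, 0 < e → ∀ u : ℝ, ⌊Int.fract u / e⌋₊ < ⌊1 / e⌋₊ + 1 := by
    intro e he u
    exact Nat.lt_succ_of_le (Nat.floor_le_floor
      (div_le_div_of_nonneg_right (Int.fract_lt_one u).le he.le))
  have hclose : ∀ e : ℝ, 0 < e → ∀ u u' : ℝ, ⌊Int.fract u / e⌋₊ = ⌊Int.fract u' / e⌋₊ →
      |Int.fract u - Int.fract u'| < e := by
    intro e he u u' h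
    have h1 : 0 ≤ Int.fract u / e := div_nonneg (Int.fract_nonneg u) he.le
    have h2 : 0 ≤ Int.fract u' / e := div_nonneg (Int.fract_nonneg u') he.le
    have a1 := Nat.floor_le h1
    have a2 := Nat.lt_floor_add_one (Int.fract u / e)
    have b1 := Nat.floor_le h2
    have b2 := Nat.lt_floor_add_one (Int.fract u' / e)
    rw [h] at a1 a2
    have : |Int.fract u / e - Int.fract u' / e| < 1 := by
      rw [abs_lt]; constructor <;> linarith
    rw [← sub_div, abs_div, abs_of_pos he, div_lt_one he] at this
    exact this
  have hcard : (Finset.range A ×ˢ Finset.range B).card < (Finset.range (n + 1)).card := by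
    rw [Finset.card_product, Finset.card_range, Finset.card_range, Finset.card_range]
    have h1 : (A : ℝ) ≤ 2 / a := by
      have h0 : (⌊1 / a⌋₊ : ℝ) ≤ 1 / a := Nat.floor_le (by positivity)
      have h2 : 1 ≤ 1 / a := by rwa [le_div_iff₀ ha, one_mul]
      rw [hA]; push_cast
      have : 2 / a = 1 / a + 1 / a := by ring
      linarith
    have h2 : (B : ℝ) ≤ 2 / d := by
      have h0 : (⌊1 / d⌋₊ : ℝ) ≤ 1 / d := Nat.floor_le (by positivity)
      have h2 : 1 ≤ 1 / d := by rwa [le_div_iff₀ hd, one_mul]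
      rw [hB]; push_cast
      have : 2 / d = 1 / d + 1 / d := by ring
      linarith
    have h3 : (A : ℝ) * B ≤ Q := by
      calc (A : ℝ) * B ≤ 2 / a * (2 / d) := by gcongr
        _ = 4 / (a * d) := by field_simp; norm_num
        _ ≤ Q := by rw [div_le_iff₀ (by positivity)]; linarith
    have h4 : Q < n + 1 := Nat.lt_floor_add_one Q
    exact_mod_cast h3.trans_lt h4
  obtain ⟨k, hk, l, hl, hkl, heq⟩ := Finset.exists_ne_map_eq_of_card_lt_of_maps_to hcard
    (f := fun k => (⌊Int.fract (k * x) / a⌋₊, ⌊Int.fract (Z k) / d⌋₊))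
    (fun k _ => by
      simp only [Finset.coe_product, Finset.coe_range, Set.mem_prod, Set.mem_Iio]
      exact ⟨hbox a ha _, hbox d hd _⟩)
  wlog hlt : l < k generalizing k l
  · exact this l hl k hk hkl.symm heq.symm (lt_of_le_of_ne (not_lt.1 hlt) hkl)
  simp only [Prod.mk.injEq] at heq
  have h1 := hclose a ha _ _ heq.1
  have h2 := hclose d hd _ _ heq.2
  refine ⟨k - l, ⌊(k : ℝ) * x⌋ - ⌊(l : ℝ) * x⌋, ⌊Z k⌋ - ⌊Z l⌋, by omega, ?_, ?_, ?_⟩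
  · have h3 : k ≤ n := by simpa [Nat.lt_succ_iff] using hk
    have h4 : (k : ℝ) ≤ Q := le_trans (by exact_mod_cast h3) (Nat.floor_le hQ0.le)
    push_cast
    have : (0 : ℝ) ≤ l := l.cast_nonneg
    linarith
  · refine lt_of_eq_of_lt ?_ h1
    rw [Int.fract, Int.fract]
    push_cast
    ring_nf
  · refine lt_of_eq_of_lt ?_ h2
    rw [Int.fract, Int.fract, hZ]
    simp only [hY, Int.fract]
    push_cast
    ring_nf

end Curvature

theorem den2_div_le {q : ℤ} (hq : 1 ≤ q) (p₁ p₂ : ℤ) :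
    (den2 ((p₁ / q : ℚ), (p₂ / q : ℚ)) : ℝ) ≤ q := by
  have h : ((den2 ((p₁ / q : ℚ), (p₂ / q : ℚ)) : ℕ) : ℤ) ∣ q := by
    have hd : ∀ p : ℤ, (p / q : ℚ).den ∣ q.natAbs := fun p => by
      rw [← Rat.divInt_eq_div]
      exact Int.natCast_dvd.1 (Rat.den_dvd p q)
    exact Int.natCast_dvd.2 (Nat.lcm_dvd (hd p₁) (hd p₂))
  exact_mod_cast Int.le_of_dvd (by omega) h

theorem finite_setOf_den_le_and_abs_le (n : ℕ) (K : ℝ) :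
    {r : ℚ | r.den ≤ n ∧ |(r : ℝ)| ≤ K}.Finite := by
  refine (((Finset.Icc (-⌈K * n⌉) ⌈K * n⌉) ×ˢ Finset.range (n + 1)).finite_toSet.image
    fun p : ℤ × ℕ => (p.1 / p.2 : ℚ)).subset ?_
  rintro r ⟨hd, hr⟩
  refine ⟨(r.num, r.den), ?_, Rat.num_div_den r⟩
  have hK : 0 ≤ K := (abs_nonneg _).trans hr
  have hnum : |(r.num : ℝ)| ≤ K * n := by
    have h1 : (r.num : ℝ) = r * r.den := by exact_mod_cast (Rat.mul_den_eq_num r).symm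
    rw [h1, abs_mul, Nat.abs_cast]
    gcongr
  have hle := abs_le.1 (hnum.trans (Int.le_ceil _))
  simp only [Finset.coe_product, Finset.coe_Icc, Finset.coe_range, Set.mem_prod, Set.mem_Icc,
    Set.mem_Iio]
  exact ⟨⟨by exact_mod_cast hle.1, by exact_mod_cast hle.2⟩, by omega⟩

theorem finite_setOf_den2_le (f : ℝ → ℝ) {I : Set ℝ} {K : ℝ} (hI : ∀ x ∈ I, |x| ≤ K) (Q e : ℝ) :
    {r : ℚ × ℚ | (den2 r : ℝ) ≤ Q ∧ ((r.1 : ℝ) ∈ I) ∧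
      |f (r.1 : ℝ) - (r.2 : ℝ)| < e}.Finite := by
  refine ((finite_setOf_den_le_and_abs_le ⌊Q⌋₊ K).biUnion fun r _ =>
    (finite_setOf_den_le_and_abs_le ⌊Q⌋₊ (e + |f r|)).image (Prod.mk r)).subset ?_
  rintro ⟨r, s⟩ ⟨hd, hr, hs⟩
  have hd' : den2 (r, s) ≤ ⌊Q⌋₊ := Nat.le_floor hd
  have hpos : 0 < den2 (r, s) := Nat.lcm_pos r.den_pos s.den_pos
  refine Set.mem_biUnion (x := r)
    ⟨(Nat.le_of_dvd hpos (Nat.dvd_lcm_left _ _)).trans hd', hI _ hr⟩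
    ⟨s, ⟨(Nat.le_of_dvd hpos (Nat.dvd_lcm_right _ _)).trans hd', ?_⟩, rfl⟩
  have := abs_sub_abs_le_abs_sub (s : ℝ) (f r)
  rw [abs_sub_comm] at this
  dsimp only at hs
  linarith

theorem volume_le_of_forall_exists_near {S : Set (ℚ × ℚ)} (hS : S.Finite) {G : Set ℝ} {ρ : ℝ}
    (hG : ∀ x ∈ G, ∃ r ∈ S, |(r.1 : ℝ) - x| ≤ ρ) :
    volume G ≤ ENNReal.ofReal (Nat.card S * (2 * ρ)) := by
  have hsub : G ⊆ ⋃ r ∈ hS.toFinset, Metric.closedBall ((r.1 : ℚ) : ℝ) ρ := by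
    intro x hx
    obtain ⟨r, hr, hrx⟩ := hG x hx
    refine Set.mem_biUnion (x := r) (by simpa using hr) ?_
    rwa [Metric.mem_closedBall, Real.dist_eq, abs_sub_comm]
  refine (measure_mono hsub).trans ((measure_biUnion_finset_le _ _).trans ?_)
  simp only [Real.volume_closedBall, Finset.sum_const, nsmul_eq_mul]
  rw [Nat.card_coe_set_eq, Set.ncard_eq_toFinset_card S hS,
    ENNReal.ofReal_mul (Nat.cast_nonneg _), ENNReal.ofReal_natCast]

section Counting

variable {f f' f'' : ℝ → ℝ} {c C : ℝ}

theorem HasCurvature.abs_sub_sub_le {x y ρ : ℝ}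
    (h : HasCurvature f f' f'' c C (Metric.closedBall x ρ)) (hy : |y - x| ≤ ρ) :
    |f y - f x - f' x * (y - x)| ≤ C * ρ ^ 2 := by
  have hρ : 0 ≤ ρ := (abs_nonneg _).trans hy
  have hord : (Metric.closedBall x ρ).OrdConnected := by
    rw [Real.closedBall_eq_Icc]; exact Set.ordConnected_Icc
  have hx : x ∈ Metric.closedBall x ρ := Metric.mem_closedBall_self hρ
  have hy' : y ∈ Metric.closedBall x ρ := by rwa [Metric.mem_closedBall, Real.dist_eq]
  obtain ⟨ξ, hξ, e⟩ := exists_slope_eq hord h.1 hy' hx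
  have hξ' := hord.uIcc_subset hy' hx hξ
  obtain ⟨ζ, hζ, e'⟩ := exists_slope_eq hord h.2 hξ' hx
  have hζ' := h.4 ζ (hord.uIcc_subset hξ' hx hζ)
  rw [Metric.mem_closedBall, Real.dist_eq] at hξ'
  have hC : 0 ≤ C := (abs_nonneg _).trans hζ'
  rw [show f y - f x - f' x * (y - x) = f'' ζ * (ξ - x) * (y - x) by rw [e, ← e']; ring,
    abs_mul, abs_mul]
  calc |f'' ζ| * |ξ - x| * |y - x| ≤ C * ρ * ρ := by gcongr
    _ = _ := by ring

/-- A point where no integer vector is short is close to a rational point near the curve. -/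
theorem HasCurvature.exists_rat_near {w : Bool → Fin 3 → ℝ} {Q a d κ ε x : ℝ} (ha : 0 < a)
    (hd : 0 < d) (ha1 : a ≤ 1) (hd1 : d ≤ 1) (hQ : 4 ≤ a * d * Q) (hκ : 0 < κ) (hQ0 : 0 < Q)
    (hw0 : ε * w true 0 = κ * Q) (hw1 : ε * w true 1 = a) (hw2 : ε * w true 2 = d)
    (h : HasCurvature f f' f'' c C (Metric.closedBall x (a / (κ * Q))))
    (hx : ∀ v : Fin 3 → ℤ, v ≠ 0 → ¬ Short f f' w (true, v) ε x) :
    ∃ r : ℚ × ℚ, (den2 r : ℝ) ≤ Q ∧ |(r.1 : ℝ) - x| ≤ a / (κ * Q) ∧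
      |f r.1 - r.2| ≤ C * (a / (κ * Q)) ^ 2 + d / (κ * Q) := by
  obtain ⟨q, p₁, p₂, hq1, hqQ, h1, h2⟩ :=
    exists_simultaneous_approx ha hd ha1 hd1 hQ x (f x) (f' x)
  have hq0 : (0 : ℝ) < q := by exact_mod_cast hq1
  have hlarge : κ * Q ≤ q := by
    by_contra! hlt
    refine hx ![q, p₁, p₂] (fun h0 => ?_) fun i => ?_
    · have := congrFun h0 0
      simp at this
      omega
    · fin_cases i
      · change |(q : ℝ)| < ε * w true 0
        rwa [hw0, abs_of_pos hq0]
      · change |(q : ℝ) * x - p₁| < ε * w true 1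
        rwa [hw1]
      · change |(q : ℝ) * f x - p₂ - f' x * (q * x - p₁)| < ε * w true 2
        rwa [hw2]
  have hκQ : 0 < κ * Q := by positivity
  have hdiv : ∀ z e : ℝ, 0 < e → |q * z| < e → |z| ≤ e / (κ * Q) := by
    intro z e he hz
    rw [abs_mul, abs_of_pos hq0] at hz
    rw [le_div_iff₀ hκQ]
    nlinarith [abs_nonneg z]
  have hr1 : |((p₁ / q : ℚ) : ℝ) - x| ≤ a / (κ * Q) := by
    refine hdiv _ _ ha ?_
    rw [← abs_neg]
    convert h1 using 2
    push_cast
    field_simp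
    ring
  refine ⟨((p₁ / q : ℚ), (p₂ / q : ℚ)), (den2_div_le hq1 p₁ p₂).trans hqQ, hr1, ?_⟩
  have ht := h.abs_sub_sub_le hr1
  have h3 : |f x + f' x * (((p₁ / q : ℚ) : ℝ) - x) - ((p₂ / q : ℚ) : ℝ)| ≤ d / (κ * Q) := by
    refine hdiv _ _ hd ?_
    convert h2 using 2
    push_cast
    field_simp
    ring
  refine le_trans (le_of_eq_of_le ?_ (abs_add_le _ _)) (add_le_add ht h3)
  congr 1
  ring

theorem HasCurvature.exists_le_Nf {α β m K : ℝ} {I : Set ℝ} (hαβ : α < β) (hm : 0 < m)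
    (hc : 0 < c) (hc1 : c ≤ 1) (hC1 : 1 ≤ C)
    (h : HasCurvature f f' f'' c C (Set.Icc (α - m) (β + m))) (hI : Set.Icc (α - m) (β + m) ⊆ I)
    (hIK : ∀ x ∈ I, |x| ≤ K) {ψ : ℝ → ℝ} (hψ : ∀ x, 0 < x → 0 < ψ x)
    (hψ0 : Tendsto ψ atTop (nhds 0)) (htψ : Tendsto (fun t : ℝ => t * ψ t) atTop atTop) :
    ∃ c₀ > 0, ∀ᶠ Q : ℝ in atTop, c₀ * Q ^ 2 * ψ Q ≤ (Nf f ψ Q I : ℝ) := by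
  obtain ⟨ε, hε, -, T, hT, hbad⟩ := h.exists_volume_short_le hαβ hm hc hc1 hC1
  set κ := ε ^ 3 / 8 with hκ
  have hκ0 : 0 < κ := by positivity
  set M := 32 / κ with hM
  have hM0 : 0 < M := by positivity
  have hC0 : 0 < C := by linarith
  set D := min 1 (min (ε * T⁻¹ / M) (min (1 / M) (min (κ ^ 2 / (2 * C * M ^ 2)) (m * κ / M))))
    with hD
  have hT0 : 0 < T := by linarith
  have hD0 : 0 < D := by positivity
  have hba : 0 < β - α := by linarith
  refine ⟨(β - α) * κ / (4 * M), by positivity, ?_⟩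
  have hδ : Tendsto (fun Q : ℝ => (Q * ψ Q)⁻¹) atTop (nhds 0) := htψ.inv_tendsto_atTop
  filter_upwards [eventually_ge_atTop 1, eventually_ge_atTop (8 * T / ε ^ 2),
    hδ.eventually_le_const hD0,
    hψ0.eventually_le_const (show 0 < min (4 * ε / κ) (4 / κ) by positivity)]
    with Q hQ1 hQT hδD hψs
  have hQ : 0 < Q := by linarith
  have hp := hψ Q hQ
  set δ := (Q * ψ Q)⁻¹ with hδdef
  set p := ψ Q with hpdef
  have hδ0 : 0 < δ := by positivity
  have hprod : Q * p * δ = 1 := mul_inv_cancel₀ (by positivity)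
  simp only [hD, le_min_iff] at hδD hψs
  obtain ⟨d1, d2, d3, d4, d5⟩ := hδD
  rw [le_div_iff₀ (by positivity)] at d2 d3 d4 d5
  obtain ⟨p1, p2⟩ := hψs
  rw [le_div_iff₀ (by positivity)] at p1 p2
  rw [div_le_iff₀ (by positivity)] at hQT
  have hκM : κ * M = 32 := by rw [hM]; field_simp
  have hb := hbad (ε ^ 2 * Q / 8) (M * δ / ε) (κ / 4 * p / ε) (by positivity) (by positivity)
    (by
      have : ε ^ 2 * Q / 8 * (M * δ / ε) * (κ / 4 * p / ε) = (κ * M) * (Q * p * δ) / 32 := by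
        field_simp; ring
      rw [this, hκM, hprod]; norm_num)
    (by linarith) (by rw [div_le_iff₀ hε]; linarith) (by rw [div_le_one hε]; linarith)
  set ρ := M * δ / (κ * Q) with hρ
  have hρ0 : 0 < ρ := by positivity
  have hρm : ρ ≤ m := by
    rw [hρ, div_le_iff₀ (by positivity)]
    calc M * δ ≤ m * κ := by linarith
      _ ≤ m * (κ * Q) := by rw [← mul_assoc]; exact le_mul_of_one_le_right (by positivity) hQ1
  have herr : C * ρ ^ 2 + κ / 4 * p / (κ * Q) < p / Q := by
    have e1 : κ / 4 * p / (κ * Q) = 1 / 4 * (p / Q) := by field_simp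
    have e2 : C * ρ ^ 2 = C * M ^ 2 * δ ^ 3 / κ ^ 2 * (p / Q) := by
      have : p / Q = 1 / (Q ^ 2 * δ) := by
        rw [eq_div_iff (by positivity), ← hprod]; field_simp
      rw [this, hρ]; field_simp
    have e3 : C * M ^ 2 * δ ^ 3 / κ ^ 2 ≤ 1 / 2 := by
      rw [div_le_iff₀ (by positivity)]
      have : δ ^ 3 ≤ δ := pow_le_of_le_one hδ0.le d1 (by norm_num)
      have : C * M ^ 2 * δ ^ 3 ≤ C * M ^ 2 * δ := by gcongr
      linarith
    rw [e1, e2, ← add_mul]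
    exact mul_lt_of_lt_one_left (by positivity) (by linarith)
  have hgood := volume_le_of_forall_exists_near (finite_setOf_den2_le f hIK Q (p / Q))
    (G := Set.Icc α β \ {x ∈ Set.Icc α β | ∃ v : Fin 3 → ℤ, v ≠ 0 ∧
        Short f f' (dualWeights (ε ^ 2 * Q / 8) (M * δ / ε) (κ / 4 * p / ε)) (true, v) ε x})
    (by
      rintro x ⟨hx, hxb⟩
      have hsub : Metric.closedBall x ρ ⊆ Set.Icc (α - m) (β + m) := by
        rw [Real.closedBall_eq_Icc]
        exact Set.Icc_subset_Icc (by linarith [hx.1]) (by linarith [hx.2])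
      obtain ⟨r, hr1, hr2, hr3⟩ := HasCurvature.exists_rat_near
        (w := dualWeights (ε ^ 2 * Q / 8) (M * δ / ε) (κ / 4 * p / ε)) (Q := Q) (a := M * δ)
        (d := κ / 4 * p) (κ := κ) (ε := ε) (x := x) (by positivity) (by positivity)
        (by linarith) (by linarith)
        (by
          have : M * δ * (κ / 4 * p) * Q = (κ * M) * (Q * p * δ) / 4 := by ring
          rw [this, hκM, hprod]; norm_num)
        hκ0 hQ (by simp only [dualWeights, Matrix.cons_val]; rw [hκ]; ring)
        (by simp only [dualWeights, Matrix.cons_val]; field_simp)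
        (by simp only [dualWeights, Matrix.cons_val]; field_simp) (h.mono hsub)
        (fun v hv hs => hxb ⟨hx, v, hv, hs⟩)
      refine ⟨r, ⟨hr1, hI (hsub ?_), hr3.trans_lt herr⟩, hr2⟩
      rwa [Metric.mem_closedBall, Real.dist_eq])
  have htot : ENNReal.ofReal (β - α) ≤
      ENNReal.ofReal ((β - α) / 2) + ENNReal.ofReal (Nf f ψ Q I * (2 * ρ)) := by
    rw [← Real.volume_Icc]
    refine (measure_mono ?_).trans ((measure_union_le _ _).trans (add_le_add hb hgood))
    rw [Set.union_sdiff_self]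
    exact Set.subset_union_right
  rw [← ENNReal.ofReal_add (by positivity) (by positivity),
    ENNReal.ofReal_le_ofReal_iff (by positivity)] at htot
  have e4 : (β - α) * κ / (4 * M) * Q ^ 2 * p * (4 * ρ) = (β - α) * (Q * p * δ) := by
    rw [hρ]; field_simp
  rw [hprod, mul_one] at e4
  refine le_of_mul_le_mul_right ?_ (show 0 < 4 * ρ by positivity)
  rw [e4]
  linarith

end Counting

theorem ContDiffOn.hasCurvature {f : ℝ → ℝ} {c C : ℝ} {s : Set ℝ} (hs : IsOpen s)
    (hf : ContDiffOn ℝ 2 f s) (hle : ∀ x ∈ s, c ≤ |iteratedDerivWithin 2 f s x|)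
    (hge : ∀ x ∈ s, |iteratedDerivWithin 2 f s x| ≤ C) :
    HasCurvature f (deriv f) (deriv (deriv f)) c C s := by
  have hit : ∀ x ∈ s, iteratedDerivWithin 2 f s x = deriv (deriv f) x := fun x hx => by
    rw [iteratedDerivWithin_of_isOpen hs hx, iteratedDeriv_succ, iteratedDeriv_one]
  have h1 : ContDiffOn ℝ 1 (deriv f) s := ((contDiffOn_succ_iff_deriv_of_isOpen hs).1
    (by simpa [one_add_one_eq_two] using hf)).2.2
  refine ⟨fun x hx => ?_, fun x hx => ?_, fun x hx => hit x hx ▸ hle x hx,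
    fun x hx => hit x hx ▸ hge x hx⟩
  · exact ((hf.differentiableOn (by norm_num)).differentiableAt (hs.mem_nhds hx)).hasDerivAt
  · exact ((h1.differentiableOn (by norm_num)).differentiableAt (hs.mem_nhds hx)).hasDerivAt

theorem counting_lower_bound
    (a b : ℝ) (hab : a < b)
    (f : ℝ → ℝ) (hf : ContDiffOn ℝ 3 f (Set.Ioo a b))
    (c₁ c₂ : ℝ) (hc₁ : 0 < c₁)
    (hfb : ∀ x ∈ Set.Ioo a b,
      c₁ ≤ |iteratedDerivWithin 2 f (Set.Ioo a b) x| ∧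
      |iteratedDerivWithin 2 f (Set.Ioo a b) x| ≤ c₂)
    (ψ : ℝ → ℝ) (hψ : IsApproxFun ψ)
    (hψ0 : Tendsto ψ atTop (nhds 0))
    (htψ : Tendsto (fun t : ℝ => t * ψ t) atTop atTop) :
    ∀ I ⊆ Set.Ioo a b, I.OrdConnected →
      ∃ c > 0, ∀ᶠ Q : ℝ in atTop,
        c * Q ^ 2 * ψ Q * (volume I).toReal ≤ (Nf f ψ Q I : ℝ) := by
  intro I hI hord
  by_cases h0 : (volume I).toReal = 0
  · exact ⟨1, one_pos, Eventually.of_forall fun Q => by rw [h0, mul_zero]; positivity⟩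
  have hV : 0 < (volume I).toReal := lt_of_le_of_ne ENNReal.toReal_nonneg (Ne.symm h0)
  have hnt : I.Nontrivial := by
    by_contra hn
    rw [Set.not_nontrivial_iff] at hn
    exact h0 (by rw [hn.measure_zero]; rfl)
  obtain ⟨u, hu, v, hv, huv⟩ := hnt.exists_lt
  have huvI : Set.Icc u v ⊆ I := hord.out hu hv
  have hcurv : HasCurvature f (deriv f) (deriv (deriv f)) (min c₁ 1) (max c₂ 1) (Set.Ioo a b) :=
    (hf.of_le (by norm_num)).hasCurvature isOpen_Ioo
      (fun x hx => (min_le_left _ _).trans (hfb x hx).1)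
      fun x hx => (hfb x hx).2.trans (le_max_left _ _)
  have e : Set.Icc ((2 * u + v) / 3 - (v - u) / 3) ((u + 2 * v) / 3 + (v - u) / 3) =
      Set.Icc u v := by congr 1 <;> ring
  obtain ⟨c₀, hc₀, hev⟩ := HasCurvature.exists_le_Nf (α := (2 * u + v) / 3)
    (β := (u + 2 * v) / 3) (m := (v - u) / 3) (K := max |a| |b|) (I := I) (by linarith)
    (by linarith) (lt_min hc₁ one_pos) (min_le_right _ _) (le_max_right _ _)
    (hcurv.mono (by rw [e]; exact huvI.trans hI)) (by rwa [e])
    (fun x hx => abs_le_max_abs_abs (hI hx).1.le (hI hx).2.le) hψ.2 hψ0 htψ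
  refine ⟨c₀ / (volume I).toReal, by positivity, hev.mono fun Q hQ => le_of_eq_of_le ?_ hQ⟩
  field_simp
end
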